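/- Let R be a local Gorenstein ring and let I be an R-ideal of grade g satisfying condition G_s for some s ≥ g+1 and unmixed locally in codimension s. Suppose I is weakly (s−1)-residually S_2 and that Ext^{g+j}_R(R/I^j, R)_𝔭 = 0 whenever 𝔭 ∈ V(I) with dim R_𝔭 ≤ s and 1 ≤ j ≤ s−g. Let 𝔞 : I be an s-residual intersection of I and suppose that 𝔞 and I have the same radical. Then for a positive integer n, I^n ⊆ 𝔞 if and only if I^{n+s−g} ∩ 𝔞 ⊆ 𝔞 I^{s−g}. -/

import Mathlib

noncomputable section

open IsLocalRing CategoryTheory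

universe u

/-- The Krull dimension of the localization `R_p`, i.e. the height of the prime `p`. -/
noncomputable def dimAt {R : Type*} [CommRing R] (p : Ideal R) (hp : p.IsPrime) : WithBot ℕ∞ :=
  haveI := hp
  ringKrullDim (Localization.AtPrime p)

/-- The minimal number of generators of a module, as an extended natural number. -/
noncomputable def mu (R M : Type*) [CommRing R] [AddCommGroup M] [Module R M] : ℕ∞ :=
  sInf {n : ℕ∞ | ∃ s : Finset M, (s.card : ℕ∞) = n ∧ Submodule.span R (s : Set M) = ⊤}

/-- The grade of an ideal: the supremum of the lengths of regular sequences contained in it. -/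
noncomputable def idealGrade {R : Type*} [CommRing R] (I : Ideal R) : ℕ∞ :=
  sSup {n : ℕ∞ | ∃ l : List R, (∀ x ∈ l, x ∈ I) ∧ RingTheory.Sequence.IsRegular R l ∧
    (l.length : ℕ∞) = n}

/-- The height of an ideal: the infimum of the heights of the primes containing it. -/
noncomputable def idealHeight {R : Type*} [CommRing R] (K : Ideal R) : WithBot ℕ∞ :=
  sInf {d | ∃ (p : Ideal R) (hp : p.IsPrime), K ≤ p ∧ d = dimAt p hp}

/-- A local ring is Cohen--Macaulay if its depth (the grade of the maximal ideal)
equals its Krull dimension. -/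
def IsCohenMacaulayLocalRing (R : Type*) [CommRing R] [IsLocalRing R] : Prop :=
  (idealGrade (maximalIdeal R) : WithBot ℕ∞) = ringKrullDim R

/-- A local ring is Gorenstein if it is Cohen--Macaulay and some maximal regular sequence
(i.e. a regular sequence of length `dim R` inside the maximal ideal) generates an
irreducible ideal. -/
def IsGorensteinLocalRing (R : Type*) [CommRing R] [IsLocalRing R] : Prop :=
  IsCohenMacaulayLocalRing R ∧
  ∃ l : List R, (∀ x ∈ l, x ∈ maximalIdeal R) ∧ RingTheory.Sequence.IsRegular R l ∧
    ((l.length : ℕ∞) : WithBot ℕ∞) = ringKrullDim R ∧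
    ∀ J K : Ideal R, J ⊓ K = Ideal.ofList l → (J = Ideal.ofList l ∨ K = Ideal.ofList l)

/-- Serre's condition `S_2` for a ring: `depth A_p ≥ min (2, dim A_p)` for all primes `p`. -/
def SerreS2 (A : Type*) [CommRing A] : Prop :=
  ∀ (p : Ideal A) (hp : p.IsPrime),
    haveI := hp
    min (2 : WithBot ℕ∞) (ringKrullDim (Localization.AtPrime p)) ≤
      (idealGrade (maximalIdeal (Localization.AtPrime p)) : WithBot ℕ∞)

/-- Condition `G_s` for an ideal: `μ(I_p) ≤ dim R_p` for every prime `p ⊇ I`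
with `dim R_p ≤ s - 1`. -/
def IdealGs {R : Type*} [CommRing R] (I : Ideal R) (s : ℕ) : Prop :=
  ∀ (p : Ideal R) (hp : p.IsPrime), I ≤ p → dimAt p hp < (s : WithBot ℕ∞) →
    haveI := hp
    ((mu (Localization.AtPrime p)
        (I.map (algebraMap R (Localization.AtPrime p))) : ℕ∞) : WithBot ℕ∞) ≤ dimAt p hp

/-- An `s`-residual intersection of `I`: a proper ideal `K = 𝔞 : I` where `𝔞 ⊆ I` is
generated by at most `s` elements and `height K ≥ s`. -/
def IsResidualIntersection {R : Type*} [CommRing R] (I 𝔞 : Ideal R) (s : ℕ) : Prop :=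
  𝔞 ≤ I ∧ (∃ f : Fin s → R, Ideal.span (Set.range f) = 𝔞) ∧
    Submodule.colon 𝔞 I ≠ ⊤ ∧ (s : WithBot ℕ∞) ≤ idealHeight (Submodule.colon 𝔞 I)

/-- A geometric `s`-residual intersection: an `s`-residual intersection `K = 𝔞 : I`
with moreover `height (I + K) ≥ s + 1`. -/
def IsGeometricResidualIntersection {R : Type*} [CommRing R] (I 𝔞 : Ideal R) (s : ℕ) : Prop :=
  IsResidualIntersection I 𝔞 s ∧
    ((s + 1 : ℕ) : WithBot ℕ∞) ≤ idealHeight (I ⊔ Submodule.colon 𝔞 I)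

/-- `I` (of grade `g`) is weakly `(s-1)`-residually `S_2`: for every `g ≤ i ≤ s - 1` and
every geometric `i`-residual intersection `K = 𝔞 : I` of `I`, the ring `R/K`
satisfies Serre's condition `S_2`. -/
def WeaklyResiduallyS2Lt {R : Type*} [CommRing R] (I : Ideal R) (g s : ℕ) : Prop :=
  ∀ i : ℕ, g ≤ i → i < s → ∀ 𝔞 : Ideal R, IsGeometricResidualIntersection I 𝔞 i →
    SerreS2 (R ⧸ Submodule.colon 𝔞 I)

/-- The localization at `p` of `Ext_R^n(M, N)` vanishes. -/
def ExtVanishesAt {R : Type u} [CommRing R] (M N : Type u) [AddCommGroup M] [Module R M]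
    [AddCommGroup N] [Module R N] (n : ℕ) (p : Ideal R) (hp : p.IsPrime) : Prop :=
  haveI := hp
  Subsingleton (LocalizedModule p.primeCompl
    ↥(((Ext R (ModuleCat.{u} R) n).obj (Opposite.op (ModuleCat.of R M))).obj
        (ModuleCat.of R N)))

namespace ResidualExt

/-! ### Ext groups of modules -/

section ExtLayer

variable {R : Type u} [CommRing R]

/-- The Ext group `Ext^n(M, N)` of two `R`-modules. -/
abbrev MExt (R : Type u) [CommRing R] (M N : Type u) [AddCommGroup M] [Module R M]
    [AddCommGroup N] [Module R N] (n : ℕ) : Type u :=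
  Abelian.Ext (ModuleCat.of R M) (ModuleCat.of R N) n

variable {M M₁ M₂ M₃ N N₁ N₂ N₃ : Type u} [AddCommGroup M] [Module R M]
  [AddCommGroup M₁] [Module R M₁] [AddCommGroup M₂] [Module R M₂] [AddCommGroup M₃] [Module R M₃]
  [AddCommGroup N] [Module R N] [AddCommGroup N₁] [Module R N₁] [AddCommGroup N₂] [Module R N₂]
  [AddCommGroup N₃] [Module R N₃]

/-- Pullback of extension classes along a linear map in the first variable. -/
def pull (f : M₁ →ₗ[R] M₂) (N : Type u) [AddCommGroup N] [Module R N] (n : ℕ) :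
    MExt R M₂ N n →ₗ[R] MExt R M₁ N n :=
  (Abelian.Ext.mk₀ (ModuleCat.ofHom f)).precompOfLinear R (ModuleCat.of R N) (zero_add n)

/-- Pushforward of extension classes along a linear map in the second variable. -/
def push (M : Type u) [AddCommGroup M] [Module R M] (f : N₁ →ₗ[R] N₂) (n : ℕ) :
    MExt R M N₁ n →ₗ[R] MExt R M N₂ n :=
  (Abelian.Ext.mk₀ (ModuleCat.ofHom f)).postcompOfLinear R (ModuleCat.of R M) (add_zero n)

lemma pull_apply (f : M₁ →ₗ[R] M₂) (n : ℕ) (x : MExt R M₂ N n) :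
    pull f N n x = (Abelian.Ext.mk₀ (ModuleCat.ofHom f)).comp x (zero_add n) := rfl

lemma push_apply (f : N₁ →ₗ[R] N₂) (n : ℕ) (x : MExt R M N₁ n) :
    push M f n x = x.comp (Abelian.Ext.mk₀ (ModuleCat.ofHom f)) (add_zero n) := rfl

lemma pull_comp (f : M₁ →ₗ[R] M₂) (g : M₂ →ₗ[R] M₃) (n : ℕ) (x : MExt R M₃ N n) :
    pull (g.comp f) N n x = pull f N n (pull g N n x) := by
  rw [pull_apply, pull_apply, pull_apply, ModuleCat.ofHom_comp, Abelian.Ext.mk₀_comp_mk₀_assoc]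

lemma pull_id (n : ℕ) (x : MExt R M N n) : pull LinearMap.id N n x = x := by
  rw [pull_apply, ModuleCat.ofHom_id, Abelian.Ext.mk₀_id_comp]

lemma pull_smul (r : R) (f : M₁ →ₗ[R] M₂) (n : ℕ) (x : MExt R M₂ N n) :
    pull (r • f) N n x = r • pull f N n x := by
  rw [pull_apply, pull_apply, ← Abelian.Ext.smul_comp, ← Abelian.Ext.mk₀_smul]
  rfl

lemma pull_zero (n : ℕ) (x : MExt R M₂ N n) : pull (0 : M₁ →ₗ[R] M₂) N n x = 0 := by
  have := pull_smul (0 : R) (0 : M₁ →ₗ[R] M₂) n x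
  rwa [zero_smul, zero_smul] at this

lemma push_id_smul (r : R) (n : ℕ) (x : MExt R M N n) :
    push M (r • LinearMap.id) n x = r • x := by
  rw [push_apply, Abelian.Ext.smul_eq_comp_mk₀]
  rfl

lemma smul_eq_zero_of_forall_smul_eq_zero (r : R) (h : ∀ m : M, r • m = 0) (n : ℕ)
    (x : MExt R M N n) : r • x = 0 := by
  rw [← pull_id (n := n) x, ← pull_smul]
  have : r • (LinearMap.id : M →ₗ[R] M) = 0 := by ext m; simpa using h m
  rw [this, pull_zero]

/-- The short exact sequence of modules attached to an injection and a surjection. -/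
lemma shortExact_of (f : M₁ →ₗ[R] M₂) (g : M₂ →ₗ[R] M₃) (hf : Function.Injective f)
    (hfg : Function.Exact f g) (hg : Function.Surjective g) :
    (ModuleCat.shortComplexOfCompEqZero f g hfg.linearMap_comp_eq_zero).ShortExact :=
  ModuleCat.shortComplex_shortExact _ hfg hf hg

/-- The contravariant long exact sequence. -/
lemma exists_connecting (f : M₁ →ₗ[R] M₂) (g : M₂ →ₗ[R] M₃) (hf : Function.Injective f)
    (hfg : Function.Exact f g) (hg : Function.Surjective g) (N : Type u) [AddCommGroup N]
    [Module R N] (n : ℕ) : ∃ δ : MExt R M₁ N n →ₗ[R] MExt R M₃ N (n + 1),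
      (∀ x, δ (pull f N n x) = 0) ∧ (∀ x, δ x = 0 → ∃ y, pull f N n y = x) ∧
      (∀ x, pull g N (n + 1) (δ x) = 0) ∧ (∀ x, pull g N (n + 1) x = 0 → ∃ y, δ y = x) := by
  have hS := shortExact_of f g hf hfg hg
  refine ⟨hS.extClass.precompOfLinear R (ModuleCat.of R N) (add_comm 1 n), ?_, ?_, ?_, ?_⟩
  · intro x
    exact hS.extClass_comp_assoc x (h := add_comm 1 n)
  · intro x hx
    exact Abelian.Ext.contravariant_sequence_exact₁ hS _ x (add_comm 1 n) hx
  · intro x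
    exact hS.comp_extClass_assoc x (add_comm 1 n)
  · intro x hx
    exact Abelian.Ext.contravariant_sequence_exact₃ hS _ x hx (add_comm 1 n)

lemma pull_exact (f : M₁ →ₗ[R] M₂) (g : M₂ →ₗ[R] M₃) (hf : Function.Injective f)
    (hfg : Function.Exact f g) (hg : Function.Surjective g) (n : ℕ) (x : MExt R M₂ N n)
    (hx : pull f N n x = 0) : ∃ y, pull g N n y = x :=
  Abelian.Ext.contravariant_sequence_exact₂ (shortExact_of f g hf hfg hg) _ x hx

lemma pull_zero_injective (g : M₂ →ₗ[R] M₃) (hg : Function.Surjective g) :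
    Function.Injective (pull g N 0) := by
  have : Epi (ModuleCat.ofHom g) := (ModuleCat.epi_iff_surjective _).mpr hg
  exact Abelian.Ext.precomp_mk₀_injective_of_epi (ModuleCat.of R N) (ModuleCat.ofHom g)

/-- The covariant long exact sequence. -/
lemma exists_connecting_push (f : N₁ →ₗ[R] N₂) (g : N₂ →ₗ[R] N₃) (hf : Function.Injective f)
    (hfg : Function.Exact f g) (hg : Function.Surjective g) (M : Type u) [AddCommGroup M]
    [Module R M] (n : ℕ) : ∃ δ : MExt R M N₃ n →ₗ[R] MExt R M N₁ (n + 1),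
      ∀ x, push M f (n + 1) x = 0 → ∃ y, δ y = x := by
  have hS := shortExact_of f g hf hfg hg
  refine ⟨hS.extClass.postcompOfLinear R (ModuleCat.of R M) rfl, ?_⟩
  intro x hx
  exact Abelian.Ext.covariant_sequence_exact₁ _ hS x hx rfl

/-- `Ext^0` is `Hom`. -/
def extZeroEquiv (R : Type u) [CommRing R] (M N : Type u) [AddCommGroup M] [Module R M]
    [AddCommGroup N] [Module R N] : MExt R M N 0 ≃ₗ[R] (M →ₗ[R] N) :=
  Abelian.Ext.linearEquiv₀.trans ModuleCat.homLinearEquiv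

lemma ext_self_eq_zero (n : ℕ) (hn : 0 < n) (x : MExt R R N n) : x = 0 := by
  obtain ⟨k, rfl⟩ := Nat.exists_eq_succ_of_ne_zero hn.ne'
  have : Projective (ModuleCat.of R R) := inferInstance
  exact Abelian.Ext.eq_zero_of_projective (n := k) x

lemma finite_mext [IsNoetherianRing R] [Module.Finite R M] [Module.Finite R N] (n : ℕ) :
    Module.Finite R (MExt R M N n) :=
  ModuleCat.finite_ext R (ModuleCat.of R M) (ModuleCat.of R N) n

/-- Vanishing of the localized derived-functor Ext gives elementwise vanishing of Ext classes. -/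
lemma exists_smul_eq_zero_of_extVanishesAt (n : ℕ) (hn : 0 < n) (p : Ideal R) (hp : p.IsPrime)
    (h : ExtVanishesAt M N n p hp) (α : MExt R M N n) : ∃ u, u ∉ p ∧ u • α = 0 := by
  obtain ⟨k, rfl⟩ := Nat.exists_eq_succ_of_ne_zero hn.ne'
  let P : ProjectiveResolution (ModuleCat.of R M) := projectiveResolution _
  obtain ⟨f, hf, hα⟩ := P.extMk_surjective α (k + 1 + 1) rfl
  let K := P.complex.linearYonedaObj R (ModuleCat.of R N)
  let S := K.sc' k (k + 1) (k + 1 + 1)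
  let e : ((Ext R (ModuleCat.{u} R) (k + 1)).obj (Opposite.op (ModuleCat.of R M))).obj
      (ModuleCat.of R N) ≅ S.moduleCatLeftHomologyData.H :=
    P.isoExt (k + 1) (ModuleCat.of R N) ≪≫
      K.homologyIsoSc' k (k + 1) (k + 1 + 1) (by simp) (by simp) ≪≫ S.moduleCatHomologyIso
  let c : LinearMap.ker S.g.hom := ⟨f, hf⟩
  let x : S.moduleCatLeftHomologyData.H := Submodule.Quotient.mk c
  obtain ⟨u, hu, hux⟩ := LocalizedModule.subsingleton_iff.mp h (e.inv x)
  refine ⟨u, hu, ?_⟩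
  have h1 : u • x = 0 := by
    have h2 : e.hom (u • e.inv x) = 0 := by rw [hux, map_zero]
    rw [map_smul] at h2
    simpa using h2
  have h3 : (Submodule.Quotient.mk (u • c) :
      LinearMap.ker S.g.hom ⧸ LinearMap.range S.moduleCatToCycles) = 0 := h1
  rw [Submodule.Quotient.mk_eq_zero] at h3
  obtain ⟨w, hw⟩ := h3
  have h4 : P.complex.d (k + 1) k ≫ (show P.complex.X k ⟶ ModuleCat.of R N from w) = u • f :=
    congrArg Subtype.val hw
  rw [← hα, Abelian.Ext.smul_eq_comp_mk₀, P.extMk_comp_mk₀, P.extMk_eq_zero_iff _ _ _ _ k rfl]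
  refine ⟨w, h4.trans ?_⟩
  simp

end ExtLayer

/-! ### Local vanishing of Ext -/

section LocalVanishing

variable {R : Type u} [CommRing R]

variable {M M₁ M₂ M₃ : Type u} [AddCommGroup M] [Module R M]
  [AddCommGroup M₁] [Module R M₁] [AddCommGroup M₂] [Module R M₂] [AddCommGroup M₃] [Module R M₃]

/-- `Ext^k(M, R)` vanishes locally at `p`. -/
def EV (M : Type u) [AddCommGroup M] [Module R M] (k : ℕ) (p : Ideal R) : Prop :=
  ∀ ξ : MExt R M R k, ∃ u, u ∉ p ∧ u • ξ = 0

/-- The module `M` vanishes locally at `p`. -/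
def LZ (M : Type u) [AddCommGroup M] [Module R M] (p : Ideal R) : Prop :=
  ∀ m : M, ∃ u, u ∉ p ∧ u • m = 0

/-- The class `ε` generates `Ext^k(M, R)` locally at `p`. -/
def Gen {k : ℕ} (ε : MExt R M R k) (p : Ideal R) : Prop :=
  ∀ ξ : MExt R M R k, ∃ u, u ∉ p ∧ ∃ z : R, u • ξ = z • ε

lemma not_mem_mul {p : Ideal R} (hp : p.IsPrime) {u v : R} (hu : u ∉ p) (hv : v ∉ p) :
    u * v ∉ p :=
  fun h => (hp.mem_or_mem h).elim hu hv

lemma one_not_mem {p : Ideal R} (hp : p.IsPrime) : (1 : R) ∉ p :=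
  (Ideal.ne_top_iff_one p).mp hp.ne_top

lemma EV.of_forall_eq_zero {k : ℕ} {p : Ideal R} (hp : p.IsPrime)
    (h : ∀ ξ : MExt R M R k, ξ = 0) : EV M k p :=
  fun ξ => ⟨1, one_not_mem hp, by rw [h ξ, smul_zero]⟩

lemma EV.of_killed {k : ℕ} {p : Ideal R} {u : R} (hu : u ∉ p) (h : ∀ m : M, u • m = 0) :
    EV M k p :=
  fun ξ => ⟨u, hu, smul_eq_zero_of_forall_smul_eq_zero u h k ξ⟩

lemma EV.of_subsingleton [Subsingleton M] {k : ℕ} {p : Ideal R} (hp : p.IsPrime) : EV M k p :=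
  EV.of_killed (one_not_mem hp) fun _ => Subsingleton.elim _ _

lemma EV.of_equiv (e : M₁ ≃ₗ[R] M₂) {k : ℕ} {p : Ideal R} (h : EV M₁ k p) : EV M₂ k p := by
  intro ξ
  obtain ⟨u, hu, hξ⟩ := h (pull e.toLinearMap R k ξ)
  refine ⟨u, hu, ?_⟩
  have h1 : pull e.symm.toLinearMap R k (pull e.toLinearMap R k (u • ξ)) = u • ξ := by
    rw [← pull_comp, LinearEquiv.comp_symm, pull_id]
  rw [← h1, map_smul, hξ, map_zero]

lemma EV.mono {k : ℕ} {p q : Ideal R} (h : EV M k p) (hqp : q ≤ p) : EV M k q := fun ξ =>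
  let ⟨u, hu, hξ⟩ := h ξ
  ⟨u, fun hq => hu (hqp hq), hξ⟩

section Exact

variable {f : M₁ →ₗ[R] M₂} {g : M₂ →ₗ[R] M₃} {p : Ideal R}

lemma EV.mid (hp : p.IsPrime) (hf : Function.Injective f) (hfg : Function.Exact f g)
    (hg : Function.Surjective g) {k : ℕ} (h₁ : EV M₁ k p) (h₃ : EV M₃ k p) : EV M₂ k p := by
  intro ξ
  obtain ⟨u, hu, hξ⟩ := h₁ (pull f R k ξ)
  rw [← map_smul] at hξ
  obtain ⟨y, hy⟩ := pull_exact f g hf hfg hg k _ hξ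
  obtain ⟨v, hv, hvy⟩ := h₃ y
  refine ⟨v * u, not_mem_mul hp hv hu, ?_⟩
  rw [mul_smul, ← hy, ← map_smul, hvy, map_zero]

lemma EV.right (hp : p.IsPrime) (hf : Function.Injective f) (hfg : Function.Exact f g)
    (hg : Function.Surjective g) {k : ℕ} (h₁ : EV M₁ k p) (h₂ : EV M₂ (k + 1) p) :
    EV M₃ (k + 1) p := by
  intro ξ
  obtain ⟨δ, -, -, -, hδ⟩ := exists_connecting f g hf hfg hg R k
  obtain ⟨u, hu, hξ⟩ := h₂ (pull g R (k + 1) ξ)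
  rw [← map_smul] at hξ
  obtain ⟨y, hy⟩ := hδ _ hξ
  obtain ⟨v, hv, hvy⟩ := h₁ y
  refine ⟨v * u, not_mem_mul hp hv hu, ?_⟩
  rw [mul_smul, ← hy, ← map_smul, hvy, map_zero]

lemma EV.right_zero (hg : Function.Surjective g) (h₂ : EV M₂ 0 p) : EV M₃ 0 p := by
  intro ξ
  obtain ⟨u, hu, hξ⟩ := h₂ (pull g R 0 ξ)
  rw [← map_smul] at hξ
  exact ⟨u, hu, pull_zero_injective g hg (by rw [hξ, map_zero])⟩

lemma EV.right' (hp : p.IsPrime) (hf : Function.Injective f) (hfg : Function.Exact f g)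
    (hg : Function.Surjective g) {k : ℕ} (h₁ : ∀ j, j + 1 = k → EV M₁ j p) (h₂ : EV M₂ k p) :
    EV M₃ k p := by
  cases k with
  | zero => exact EV.right_zero hg h₂
  | succ k => exact EV.right hp hf hfg hg (h₁ k rfl) h₂

lemma EV.left (hp : p.IsPrime) (hf : Function.Injective f) (hfg : Function.Exact f g)
    (hg : Function.Surjective g) {k : ℕ} (h₂ : EV M₂ k p) (h₃ : EV M₃ (k + 1) p) :
    EV M₁ k p := by
  intro ξ
  obtain ⟨δ, -, hδ, -, -⟩ := exists_connecting f g hf hfg hg R k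
  obtain ⟨u, hu, hξ⟩ := h₃ (δ ξ)
  rw [← map_smul] at hξ
  obtain ⟨y, hy⟩ := hδ _ hξ
  obtain ⟨v, hv, hvy⟩ := h₂ y
  refine ⟨v * u, not_mem_mul hp hv hu, ?_⟩
  rw [mul_smul, ← hy, ← map_smul, hvy, map_zero]

lemma exact_ker_rangeRestrict (f : M₁ →ₗ[R] M₂) :
    Function.Exact (LinearMap.ker f).subtype f.rangeRestrict := by
  intro x
  constructor
  · intro hx
    exact ⟨⟨x, by simpa using congrArg Subtype.val hx⟩, rfl⟩
  · rintro ⟨y, rfl⟩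
    exact Subtype.ext y.2

lemma exact_range_subtype (hfg : Function.Exact f g) :
    Function.Exact (LinearMap.range f).subtype g := by
  intro x
  rw [hfg x]
  constructor
  · rintro ⟨y, rfl⟩
    exact ⟨⟨f y, y, rfl⟩, rfl⟩
  · rintro ⟨⟨_, y, rfl⟩, rfl⟩
    exact ⟨y, rfl⟩

/-- Vanishing of Ext of a cokernel from vanishing for source, target, and kernel. -/
lemma EV.coker (hp : p.IsPrime) (hfg : Function.Exact f g) (hg : Function.Surjective g) {k : ℕ}
    (h₁ : EV M₁ k p) (hN : ∀ j, j + 1 = k → EV (LinearMap.ker f) j p) (h₂ : EV M₂ (k + 1) p) :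
    EV M₃ (k + 1) p :=
  EV.right hp (LinearMap.range f).injective_subtype (exact_range_subtype hfg) hg
    (EV.right' hp (LinearMap.ker f).injective_subtype (exact_ker_rangeRestrict f)
      f.surjective_rangeRestrict hN h₁) h₂

/-- A class on the source of a map gives a class one degree up on the cokernel. -/
lemma exists_class_coker (hp : p.IsPrime) (hfg : Function.Exact f g)
    (hg : Function.Surjective g) {k : ℕ} (hN : EV (LinearMap.ker f) k p) (ε : MExt R M₁ R k) :
    ∃ ε' : MExt R M₃ R (k + 1),
      (∀ y : R, y • ε' = 0 → ∃ v, v ∉ p ∧ ∃ η : MExt R M₂ R k, (v * y) • ε = pull f R k η) ∧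
      ((∀ j, j + 1 = k → EV (LinearMap.ker f) j p) → Gen ε p → EV M₂ (k + 1) p → Gen ε' p) := by
  have hfac : (LinearMap.range f).subtype.comp f.rangeRestrict = f := by ext; rfl
  have ex₁ := exact_ker_rangeRestrict f
  have ex₂ := exact_range_subtype hfg
  have hπ := f.surjective_rangeRestrict
  obtain ⟨u, hu, hε⟩ := hN (pull (LinearMap.ker f).subtype R k ε)
  rw [← map_smul] at hε
  obtain ⟨ε₁, hε₁⟩ := pull_exact _ _ (LinearMap.ker f).injective_subtype ex₁ hπ k _ hε
  obtain ⟨δ, -, hδ₂, -, hδ₄⟩ := exists_connecting _ _ (LinearMap.range f).injective_subtype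
    ex₂ hg R k
  refine ⟨δ ε₁, ?_, ?_⟩
  · intro y hy
    rw [← map_smul] at hy
    obtain ⟨η, hη⟩ := hδ₂ _ hy
    refine ⟨u, hu, η, ?_⟩
    rw [mul_comm, mul_smul, ← hε₁, ← map_smul, ← hη, ← pull_comp, hfac]
  · intro hN' hgen hM₂ ξ
    obtain ⟨u₁, hu₁, h₁⟩ := hM₂ (pull g R (k + 1) ξ)
    rw [← map_smul] at h₁
    obtain ⟨x, hx⟩ := hδ₄ _ h₁
    obtain ⟨u₂, hu₂, z, hz⟩ := hgen (pull f.rangeRestrict R k x)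
    have h₂ : pull f.rangeRestrict R k ((u * u₂) • x - z • ε₁) = 0 := by
      rw [map_sub, map_smul, map_smul, hε₁, mul_smul, hz, smul_comm, sub_self]
    obtain ⟨u₃, hu₃, h₃⟩ : ∃ u₃, u₃ ∉ p ∧ u₃ • ((u * u₂) • x - z • ε₁) = 0 := by
      cases k with
      | zero =>
        refine ⟨1, one_not_mem hp, ?_⟩
        rw [pull_zero_injective _ hπ (h₂.trans (map_zero _).symm), smul_zero]
      | succ k =>
        obtain ⟨δ', -, -, -, hδ'⟩ := exists_connecting _ _ (LinearMap.ker f).injective_subtype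
          ex₁ hπ R k
        obtain ⟨y, hy⟩ := hδ' _ h₂
        obtain ⟨u₃, hu₃, h₃⟩ := hN' k rfl y
        exact ⟨u₃, hu₃, by rw [← hy, ← map_smul, h₃, map_zero]⟩
    refine ⟨u₃ * (u * u₂) * u₁,
      not_mem_mul hp (not_mem_mul hp hu₃ (not_mem_mul hp hu hu₂)) hu₁, u₃ * z, ?_⟩
    rw [smul_sub, sub_eq_zero] at h₃
    rw [mul_smul, ← hx, ← map_smul, mul_smul, h₃, map_smul, map_smul, mul_smul]

end Exact

/-- A finitely generated module that vanishes locally at `p` is killed by some `u ∉ p`. -/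
lemma LZ.exists_killed [Module.Finite R M] {p : Ideal R} (hp : p.IsPrime) (h : LZ M p) :
    ∃ u, u ∉ p ∧ ∀ m : M, u • m = 0 := by
  classical
  obtain ⟨s, hs⟩ := Module.Finite.fg_top (R := R) (M := M)
  choose u hu hum using h
  refine ⟨∏ m ∈ s, u m, ?_, ?_⟩
  · intro hmem
    obtain ⟨m, -, hm⟩ := (hp.prod_mem_iff).mp hmem
    exact hu m hm
  · intro m
    have hm : m ∈ Submodule.span R (s : Set M) := hs ▸ Submodule.mem_top
    induction hm using Submodule.span_induction with
    | mem x hx =>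
      obtain ⟨c, hc⟩ := Finset.dvd_prod_of_mem u (Finset.mem_coe.mp hx)
      rw [hc, mul_comm, mul_smul, hum, smul_zero]
    | zero => exact smul_zero _
    | add x y _ _ hx hy => rw [smul_add, hx, hy, add_zero]
    | smul a x _ hx => rw [smul_comm, hx, smul_zero]

/-- Local Nakayama: if `E` is finite and every element lies locally in `J • E` for some `J ≤ p`,
then `E` vanishes locally at `p`. -/
lemma LZ.of_le_smul {E : Type u} [AddCommGroup E] [Module R E] [Module.Finite R E] {p J : Ideal R}
    (hp : p.IsPrime) (hJ : J ≤ p) (h : ∀ ξ : E, ∃ u, u ∉ p ∧ u • ξ ∈ J • (⊤ : Submodule R E)) :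
    LZ E p := by
  classical
  have h1 : LZ (E ⧸ (J • ⊤ : Submodule R E)) p := by
    intro m
    obtain ⟨ξ, rfl⟩ := Submodule.Quotient.mk_surjective _ m
    obtain ⟨u, hu, hη⟩ := h ξ
    exact ⟨u, hu, by rwa [← Submodule.Quotient.mk_smul, Submodule.Quotient.mk_eq_zero]⟩
  obtain ⟨u, hu, hE⟩ := h1.exists_killed hp
  have hrange : LinearMap.range (algebraMap R (Module.End R E) u) ≤
      J • (⊤ : Submodule R E) := by
    rintro _ ⟨ξ, rfl⟩
    have := hE (Submodule.Quotient.mk ξ)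
    rwa [← Submodule.Quotient.mk_smul, Submodule.Quotient.mk_eq_zero] at this
  obtain ⟨P, hP, -, hcoeff, hP0⟩ :=
    LinearMap.exists_monic_and_natDegree_eq_and_coeff_mem_pow_and_aeval_eq_zero R
      (algebraMap R (Module.End R E) u) J hrange
  rw [Polynomial.aeval_algebraMap_apply] at hP0
  intro ξ
  refine ⟨P.eval u, ?_, ?_⟩
  · intro hmem
    rw [Polynomial.eval_eq_sum_range, Finset.sum_range_succ, hP.coeff_natDegree, one_mul] at hmem
    have hlow : ∑ i ∈ Finset.range P.natDegree, P.coeff i * u ^ i ∈ p := by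
      refine Ideal.sum_mem _ fun i hi => Ideal.mul_mem_right _ _ ?_
      exact hJ (Ideal.pow_le_self (Nat.sub_ne_zero_of_lt (Finset.mem_range.mp hi)) (hcoeff i))
    exact hu (hp.mem_of_pow_mem _ ((Ideal.add_mem_iff_right _ hlow).mp hmem))
  · have := congrArg (fun φ : Module.End R E => φ ξ) hP0
    simpa using this

/-- If `E` is finite and every element is locally divisible by `x ∈ p`, then `E` vanishes locally
at `p`. -/
lemma local_nakayama {E : Type u} [AddCommGroup E] [Module R E] [Module.Finite R E] {p : Ideal R}
    (hp : p.IsPrime) {x : R} (hx : x ∈ p) (h : ∀ ξ : E, ∃ u, u ∉ p ∧ ∃ η : E, u • ξ = x • η) :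
    LZ E p := by
  refine LZ.of_le_smul hp ((Ideal.span_singleton_le_iff_mem p).mpr hx) fun ξ => ?_
  obtain ⟨u, hu, η, hη⟩ := h ξ
  refine ⟨u, hu, ?_⟩
  rw [hη]
  exact Submodule.smul_mem_smul (Ideal.mem_span_singleton_self x) Submodule.mem_top

end LocalVanishing

/-! ### Associated primes of ideals and regular sequences -/

section Associated

variable {R : Type u} [CommRing R]

/-- The prime `q` is associated to `R/V`. -/
def Assp (V q : Ideal R) : Prop := q.IsPrime ∧ ∃ y, ∀ w, w * y ∈ V ↔ w ∈ q

/-- The elements of `R` that lie in `J` locally at `p`. -/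
def InSat (p J : Ideal R) (y : R) : Prop := ∃ u, u ∉ p ∧ u * y ∈ J

/-- Ideals generated by regular sequences of length `n`. -/
inductive RegIdeal : Ideal R → ℕ → Prop
  | zero : RegIdeal ⊥ 0
  | succ {J : Ideal R} {i : ℕ} {b : R} : RegIdeal J i → (∀ y, y * b ∈ J → y ∈ J) →
      RegIdeal (J ⊔ Ideal.span {b}) (i + 1)

lemma Assp.le {V q : Ideal R} (h : Assp V q) : V ≤ q := by
  obtain ⟨-, y, hy⟩ := h
  exact fun v hv => (hy v).mp (V.mul_mem_right _ hv)

lemma assp_finite [IsNoetherianRing R] (V : Ideal R) : {q | Assp V q}.Finite := by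
  refine (associatedPrimes.finite R (R ⧸ V)).subset ?_
  rintro q ⟨hq, y, hy⟩
  rw [AssociatedPrimes.mem_iff, isAssociatedPrime_iff]
  refine ⟨hq, Ideal.Quotient.mk V y, ?_⟩
  ext w
  rw [Submodule.mem_colon_singleton, Submodule.mem_bot, ← hy w, ← Ideal.Quotient.eq_zero_iff_mem,
    map_mul]
  rfl

lemma exists_assp_of_not_inSat [IsNoetherianRing R] {V p : Ideal R} (hp : p.IsPrime) {y : R}
    (hy : ¬ InSat p V y) :
    ∃ q : Ideal R, q.IsPrime ∧ q ≤ p ∧ ∃ r, ∀ w, w * (r * y) ∈ V ↔ w ∈ q := by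
  let c : R → Ideal R := fun r =>
    { carrier := {w | w * (r * y) ∈ V}
      add_mem' := fun {a b} ha hb => by
        change (a + b) * (r * y) ∈ V
        rw [add_mul]
        exact V.add_mem ha hb
      zero_mem' := by change 0 * (r * y) ∈ V; simp
      smul_mem' := fun a b hb => by
        change a * b * (r * y) ∈ V
        rw [mul_assoc]
        exact V.mul_mem_left _ hb }
  have hc : ∀ r w, w ∈ c r ↔ w * (r * y) ∈ V := fun r w => Iff.rfl
  let T : Set (Ideal R) := {q | ∃ r, q = c r ∧ ∀ u, u ∉ p → u * (r * y) ∉ V}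
  have hT : T.Nonempty := ⟨c 1, 1, rfl, fun u hu h => hy ⟨u, hu, by simpa using h⟩⟩
  obtain ⟨q, ⟨r, hqr, hr⟩, hmax⟩ := set_has_maximal_iff_noetherian.mpr
    (inferInstance : IsNoetherian R R) T hT
  have hmem : ∀ r' w, (∀ u, u ∉ p → u * (r' * r * y) ∉ V) → w * (r' * r * y) ∈ V → w ∈ q := by
    intro r' w h₁ h₂
    have hle : q ≤ c (r' * r) := by
      intro a ha
      rw [hqr, hc] at ha
      rw [hc, show a * (r' * r * y) = r' * (a * (r * y)) by ring]
      exact V.mul_mem_left _ ha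
    have hnlt := hmax (c (r' * r)) ⟨_, rfl, h₁⟩
    rw [eq_of_le_of_not_lt hle hnlt]
    exact h₂
  have hqp : q ≤ p := by
    intro w hw
    by_contra hwp
    exact hr w hwp (by rw [hqr] at hw; exact hw)
  refine ⟨q, ⟨?_, ?_⟩, hqp, r, fun w => by rw [hqr, hc]⟩
  · rintro rfl
    exact hp.ne_top (top_le_iff.mp hqp)
  · intro a b hab
    by_cases h : ∀ u, u ∉ p → u * (b * r * y) ∉ V
    · refine Or.inl (hmem b a h ?_)
      rw [hqr, hc] at hab
      rwa [show a * (b * r * y) = a * b * (r * y) by ring]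
    · push Not at h
      obtain ⟨u, hu, hub⟩ := h
      refine Or.inr (hmem u b ?_ ?_)
      · intro u' hu' h'
        refine hr (u' * u) (not_mem_mul hp hu' hu) ?_
        rwa [show u' * u * (r * y) = u' * (u * r * y) by ring]
      · rwa [show b * (u * r * y) = u * (b * r * y) by ring]

lemma exists_assp_le [IsNoetherianRing R] {V p : Ideal R} (hp : p.IsPrime) {y : R}
    (hy : ¬ InSat p V y) : ∃ q, Assp V q ∧ q ≤ p ∧ ∀ w, w * y ∈ V → w ∈ q := by
  obtain ⟨q, hq, hqp, r, hr⟩ := exists_assp_of_not_inSat hp hy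
  refine ⟨q, ⟨hq, _, hr⟩, hqp, fun w hw => (hr w).mp ?_⟩
  rw [mul_left_comm]
  exact V.mul_mem_left _ hw

lemma assp_of_minimal [IsNoetherianRing R] {V q : Ideal R} (hq : q ∈ V.minimalPrimes) :
    Assp V q := by
  have hqp : q.IsPrime := hq.1.1
  have hV : V ≤ q := hq.1.2
  obtain ⟨q', hq', hle, -⟩ := exists_assp_le (V := V) hqp (y := 1)
    (by rintro ⟨u, hu, h⟩; exact hu (hV (by simpa using h)))
  have := hq.2 ⟨hq'.1, hq'.le⟩ hle
  rwa [le_antisymm this hle]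

lemma inSat_maximalIdeal [IsLocalRing R] {J : Ideal R} {y : R} :
    InSat (maximalIdeal R) J y ↔ y ∈ J := by
  constructor
  · rintro ⟨u, hu, h⟩
    have hu' : IsUnit u := by simpa using hu
    exact (Ideal.unit_mul_mem_iff_mem J hu').mp h
  · exact fun h => ⟨1, one_not_mem (maximalIdeal.isMaximal R).isPrime, by simpa using h⟩

lemma regular_of_not_mem_assp [IsNoetherianRing R] [IsLocalRing R] {V : Ideal R} {b : R}
    (h : ∀ q, Assp V q → b ∉ q) (y : R) (hy : y * b ∈ V) : y ∈ V := by
  by_contra hyV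
  obtain ⟨q, hq, -, hw⟩ := exists_assp_le (maximalIdeal.isMaximal R).isPrime
    (fun hs => hyV (inSat_maximalIdeal.mp hs))
  exact h q hq (hw b (by rwa [mul_comm]))

lemma not_mem_of_regular {V q : Ideal R} {b : R} (hb : ∀ y, y * b ∈ V → y ∈ V)
    (hq : Assp V q) : b ∉ q := by
  obtain ⟨hq, y, hy⟩ := hq
  intro hbq
  have := hb y (by rw [mul_comm]; exact (hy b).mpr hbq)
  exact one_not_mem hq ((hy 1).mp (by rwa [one_mul]))

lemma height_add_one_le {p q : Ideal R} (hp : p.IsPrime) (hq : q.IsPrime) (h : p < q) :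
    p.height + 1 ≤ q.height :=
  Ideal.height_add_one_le_of_lt_of_isPrime h

lemma exists_height_eq [IsNoetherianRing R] {p : Ideal R} (hp : p.IsPrime) :
    ∃ e : ℕ, p.height = e :=
  (ENat.ne_top_iff_exists.mp Ideal.height_ne_top_of_isPrime).imp fun _ h => h.symm

lemma exists_minimal_le {V p : Ideal R} (hp : p.IsPrime) (h : V ≤ p) :
    ∃ q ∈ V.minimalPrimes, q ≤ p :=
  Ideal.exists_minimalPrimes_le h

lemma RegIdeal.le_height [IsNoetherianRing R] {J : Ideal R} {i : ℕ} (h : RegIdeal J i) :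
    ∀ p : Ideal R, p.IsPrime → J ≤ p → (i : ℕ∞) ≤ p.height := by
  induction h with
  | zero => intro p _ _; simp
  | @succ J i b hJ hb ih =>
    intro p hp hle
    obtain ⟨q, hq, hqp⟩ := exists_minimal_le hp (le_sup_left.trans hle)
    have hbp : b ∈ p := hle (Ideal.mem_sup_right (Ideal.mem_span_singleton_self b))
    have hbq : b ∉ q := not_mem_of_regular hb (assp_of_minimal hq)
    have hlt : q < p := lt_of_le_of_ne hqp (by rintro rfl; exact hbq hbp)
    calc ((i + 1 : ℕ) : ℕ∞) = (i : ℕ∞) + 1 := by push_cast; rfl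
      _ ≤ q.height + 1 := by gcongr; exact ih q hq.1.1 hq.1.2
      _ ≤ p.height := height_add_one_le hq.1.1 hp hlt

lemma RegIdeal.mem_minimalPrimes [IsNoetherianRing R] {J q : Ideal R} {e : ℕ}
    (hJ : RegIdeal J e) (hq : q.IsPrime) (hJq : J ≤ q) (he : q.height ≤ e) : q ∈ J.minimalPrimes := by
  obtain ⟨q', hm, hle⟩ := exists_minimal_le hq hJq
  rcases hle.lt_or_eq with hlt | rfl
  · have h1 := hJ.le_height q' hm.1.1 hm.1.2
    have h2 := (height_add_one_le hm.1.1 hq hlt).trans he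
    have h3 : ((e + 1 : ℕ) : ℕ∞) ≤ e := by
      push_cast
      exact (add_le_add_left h1 1).trans h2
    have := ENat.natCast_le_natCast.mp h3
    omega
  · exact hm

/-- A prime not contained in any associated prime contains a regular element. -/
lemma exists_regular_mem [IsNoetherianRing R] [IsLocalRing R] {V q : Ideal R}
    (h : ∀ q', Assp V q' → ¬ q ≤ q') : ∃ b ∈ q, ∀ y, y * b ∈ V → y ∈ V := by
  classical
  have hfin := assp_finite V
  by_contra hcon
  push Not at hcon
  have hsub : (q : Set R) ⊆
      ⋃ q' ∈ (↑hfin.toFinset : Set (Ideal R)), ((id q' : Ideal R) : Set R) := by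
    intro b hb
    obtain ⟨y, hy, hyV⟩ := hcon b hb
    by_contra hbn
    refine hyV (regular_of_not_mem_assp (b := b) (fun q' hq' hbq' => hbn ?_) y hy)
    exact Set.mem_biUnion (x := q') (by simpa using hq') hbq'
  rw [Ideal.subset_union_prime ⊥ ⊥ (fun q' hq' _ _ => by
    have : Assp V q' := by simpa using hq'
    exact this.1)] at hsub
  obtain ⟨q', hq', hle⟩ := hsub
  exact h _ (by simpa using hq') hle

/-- Conversion of weakly regular sequences to chains of regular elements. -/
lemma RegIdeal.of_isWeaklyRegular {J : Ideal R} {i : ℕ} (hJ : RegIdeal J i) :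
    ∀ (l : List R) (K : Ideal R), (∀ k : ℕ, ∀ hk : k < l.length, ∀ y,
      y * l[k] ∈ J ⊔ Ideal.ofList (l.take k) → y ∈ J ⊔ Ideal.ofList (l.take k)) →
      K = J ⊔ Ideal.ofList l → RegIdeal K (i + l.length) := by
  intro l
  induction l generalizing J i with
  | nil => rintro K - rfl; simpa using hJ
  | cons b l ih =>
    rintro K h rfl
    have hb : ∀ y, y * b ∈ J → y ∈ J :=
      fun y hy => by simpa using h 0 (by simp) y (by simpa using hy)
    have hassoc : ∀ L : List R,
        J ⊔ Ideal.span {b} ⊔ Ideal.ofList L = J ⊔ Ideal.ofList (b :: L) := by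
      intro L
      rw [Ideal.ofList_cons, sup_assoc]
    have := ih (hJ.succ hb) (J ⊔ Ideal.ofList (b :: l)) (fun k hk y hy => by
      rw [hassoc] at hy ⊢
      exact h (k + 1) (by simpa using hk) y (by simpa using hy)) (hassoc l).symm
    rwa [List.length_cons, show i + (l.length + 1) = i + 1 + l.length by ring]

lemma regular_of_isWeaklyRegular {l : List R} (h : RingTheory.Sequence.IsWeaklyRegular R l)
    (k : ℕ) (hk : k < l.length) (y : R) (hy : y * l[k] ∈ Ideal.ofList (l.take k)) :
    y ∈ Ideal.ofList (l.take k) := by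
  have h1 := h.regular_mod_prev k hk
  have h2 : (Ideal.ofList (l.take k) • ⊤ : Submodule R R) = Ideal.ofList (l.take k) := by
    simp
  have h3 := h1 (a₁ := Submodule.Quotient.mk y) (a₂ := 0) (by
    change l[k] • Submodule.Quotient.mk y = l[k] • 0
    rw [smul_zero, ← Submodule.Quotient.mk_smul, Submodule.Quotient.mk_eq_zero, h2, smul_eq_mul,
      mul_comm]
    exact hy)
  rwa [Submodule.Quotient.mk_eq_zero, h2] at h3

lemma regIdeal_of_isWeaklyRegular {l : List R} (h : RingTheory.Sequence.IsWeaklyRegular R l) :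
    RegIdeal (Ideal.ofList l) l.length := by
  have := RegIdeal.zero.of_isWeaklyRegular l (Ideal.ofList l)
    (fun k hk y hy => by
      rw [bot_sup_eq] at hy ⊢
      exact regular_of_isWeaklyRegular h k hk y hy) (by simp)
  simpa using this

end Associated

/-! ### Vanishing of Ext over Gorenstein local rings -/

section CyclicModules

variable {R : Type u} [CommRing R]

/-- Multiplication by `b` as a map of cyclic modules. -/
def quotMul (J J' : Ideal R) (b : R) (h : ∀ y ∈ J, b * y ∈ J') : (R ⧸ J) →ₗ[R] (R ⧸ J') :=
  Submodule.mapQ J J' (LinearMap.lsmul R R b) h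

lemma quotMul_mk {J J' : Ideal R} {b : R} (h : ∀ y ∈ J, b * y ∈ J') (y : R) :
    quotMul J J' b h (Ideal.Quotient.mk J y) = Ideal.Quotient.mk J' (b * y) := rfl

lemma smul_mk (J : Ideal R) (a y : R) :
    a • Ideal.Quotient.mk J y = Ideal.Quotient.mk J (a * y) := rfl

lemma smul_quotient_eq_zero (J : Ideal R) : ∀ a ∈ J, ∀ m : R ⧸ J, a • m = 0 := fun a ha m => by
  obtain ⟨y, rfl⟩ := Ideal.Quotient.mk_surjective m
  rw [smul_mk, Ideal.Quotient.eq_zero_iff_mem]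
  exact Ideal.mul_mem_right _ _ ha

lemma quotMul_injective {J J' : Ideal R} {b : R} (h : ∀ y ∈ J, b * y ∈ J')
    (hb : ∀ y, b * y ∈ J' → y ∈ J) : Function.Injective (quotMul J J' b h) := by
  rw [injective_iff_map_eq_zero]
  intro x hx
  obtain ⟨y, rfl⟩ := Ideal.Quotient.mk_surjective x
  rw [quotMul_mk, Ideal.Quotient.eq_zero_iff_mem] at hx
  exact Ideal.Quotient.eq_zero_iff_mem.mpr (hb y hx)

lemma one_mul_mem_of_le {J J' : Ideal R} (h : J ≤ J') : ∀ y ∈ J, 1 * y ∈ J' :=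
  fun y hy => by rw [one_mul]; exact h hy

lemma quotMul_one_surjective {J J' : Ideal R} (h : J ≤ J') :
    Function.Surjective (quotMul J J' 1 (one_mul_mem_of_le h)) := by
  intro x
  obtain ⟨y, rfl⟩ := Ideal.Quotient.mk_surjective x
  exact ⟨Ideal.Quotient.mk J y, by rw [quotMul_mk, one_mul]⟩

lemma quotMul_exact {J J' : Ideal R} {b : R} (h : ∀ y ∈ J, b * y ∈ J') :
    Function.Exact (quotMul J J' b h)
      (quotMul J' (J' ⊔ Ideal.span {b}) 1 (one_mul_mem_of_le le_sup_left)) := by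
  intro x
  obtain ⟨y, rfl⟩ := Ideal.Quotient.mk_surjective x
  rw [quotMul_mk, one_mul, Ideal.Quotient.eq_zero_iff_mem, Set.mem_range]
  constructor
  · intro hy
    obtain ⟨j, hj, c, hc, rfl⟩ := Submodule.mem_sup.mp hy
    obtain ⟨a, rfl⟩ := Ideal.mem_span_singleton'.mp hc
    refine ⟨Ideal.Quotient.mk J a, ?_⟩
    rw [quotMul_mk, Ideal.Quotient.eq]
    have : b * a - (j + a * b) = -j := by ring
    rw [this]
    exact J'.neg_mem hj
  · rintro ⟨x', hx'⟩
    obtain ⟨a, rfl⟩ := Ideal.Quotient.mk_surjective x'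
    rw [quotMul_mk, Ideal.Quotient.eq] at hx'
    have : y = -(b * a - y) + a * b := by ring
    rw [this]
    exact add_mem (Ideal.mem_sup_left (J'.neg_mem hx'))
      (Ideal.mem_sup_right (Ideal.mul_mem_left _ _ (Ideal.mem_span_singleton_self b)))

lemma quotMul_self {J : Ideal R} {b : R} (h : ∀ y ∈ J, b * y ∈ J) :
    quotMul J J b h = b • LinearMap.id := by
  ext
  rfl

lemma pull_quotMul_self {J : Ideal R} {b : R} (h : ∀ y ∈ J, b * y ∈ J) {N : Type u}
    [AddCommGroup N] [Module R N] (k : ℕ) (x : MExt R (R ⧸ J) N k) :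
    pull (quotMul J J b h) N k x = b • x := by
  rw [quotMul_self, pull_smul, pull_id]

/-- The quotient of `R` by the zero ideal. -/
def quotBot (R : Type u) [CommRing R] : (R ⧸ (⊥ : Ideal R)) ≃ₗ[R] R :=
  Submodule.quotEquivOfEqBot ⊥ rfl

end CyclicModules

section Devissage

variable {R : Type u} [CommRing R] [IsNoetherianRing R]

lemma devissage {k : ℕ} {p J : Ideal R} (hp : p.IsPrime)
    (h : ∀ q : Ideal R, q.IsPrime → J ≤ q → EV (R ⧸ q) k p)
    (M : Type u) [AddCommGroup M] [Module R M] [hM : Module.Finite R M]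
    (hJ : ∀ a ∈ J, ∀ m : M, a • m = 0) : EV M k p := by
  refine IsNoetherianRing.induction_on_isQuotientEquivQuotientPrime R hM
    (motive := fun N _ _ _ => (∀ a ∈ J, ∀ m : N, a • m = 0) → EV N k p) ?_ ?_ ?_ hJ
  · intro N _ _ _ _ _
    exact EV.of_subsingleton hp
  · intro N _ _ _ q e hN
    refine EV.of_equiv e.symm (h q.1 q.2 fun a ha => ?_)
    have := congrArg e (hN a ha (e.symm (Ideal.Quotient.mk _ 1)))
    rwa [map_smul, e.apply_symm_apply, map_zero, smul_mk, mul_one,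
      Ideal.Quotient.eq_zero_iff_mem] at this
  · intro N₁ _ _ _ N₂ _ _ _ N₃ _ _ _ f g hf hg hfg h₁ h₃ hN
    refine EV.mid hp hf hfg hg (h₁ fun a ha m => hf ?_) (h₃ fun a ha m => ?_)
    · rw [map_smul, hN a ha, map_zero]
    · obtain ⟨m, rfl⟩ := hg m
      rw [← map_smul, hN a ha, map_zero]

/-- Bass's lemma: nonvanishing of Ext moves up one step when a nonzerodivisor is killed. -/
lemma EV.of_quotient {q p : Ideal R} (hq : q.IsPrime) (hp : p.IsPrime) {x : R} (hxp : x ∈ p)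
    (hxq : x ∉ q) {k : ℕ} (h : EV (R ⧸ (q ⊔ Ideal.span {x})) (k + 1) p) : EV (R ⧸ q) k p := by
  have := finite_mext (R := R) (M := R ⧸ q) (N := R) k
  have hx : ∀ y ∈ q, x * y ∈ q := fun y hy => q.mul_mem_left _ hy
  obtain ⟨δ, -, hδ, -, -⟩ := exists_connecting _ _ (quotMul_injective hx fun y hy =>
    (hq.mem_or_mem hy).resolve_left hxq) (quotMul_exact hx) (quotMul_one_surjective le_sup_left) R k
  refine local_nakayama hp hxp fun ξ => ?_
  obtain ⟨u, hu, hξ⟩ := h (δ ξ)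
  rw [← map_smul] at hξ
  obtain ⟨η, hη⟩ := hδ _ hξ
  exact ⟨u, hu, η, by rw [← hη, pull_quotMul_self]⟩

/-- Vanishing at larger primes in degree `k + 1` gives vanishing in degree `k`. -/
lemma EV.of_larger {q p : Ideal R} (hq : q.IsPrime) (hp : p.IsPrime) {x : R} (hxp : x ∈ p)
    (hxq : x ∉ q) {k : ℕ}
    (h : ∀ q' : Ideal R, q'.IsPrime → q < q' → x ∈ q' → EV (R ⧸ q') (k + 1) p) :
    EV (R ⧸ q) k p := by
  refine EV.of_quotient hq hp hxp hxq (devissage (J := q ⊔ Ideal.span {x}) hp ?_ _ ?_)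
  · intro q' hq' hle
    have hx : x ∈ q' := hle (Ideal.mem_sup_right (Ideal.mem_span_singleton_self x))
    refine h q' hq' (lt_of_le_of_ne (le_sup_left.trans hle) ?_) hx
    rintro rfl
    exact hxq hx
  · intro a ha m
    obtain ⟨y, rfl⟩ := Ideal.Quotient.mk_surjective m
    rw [smul_mk, Ideal.Quotient.eq_zero_iff_mem]
    exact Ideal.mul_mem_right _ _ ha

end Devissage

section Regular

variable {R : Type u} [CommRing R]

lemma RegIdeal.exists_lt {J : Ideal R} {i : ℕ} (h : RegIdeal J i) : ∀ k < i,
    ∃ (J' : Ideal R) (b : R), J' ≤ J ∧ RegIdeal J' k ∧ b ∈ J ∧ ∀ y, y * b ∈ J' → y ∈ J' := by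
  induction h with
  | zero => intro k hk; exact absurd hk (Nat.not_lt_zero k)
  | @succ J i b hJ hb ih =>
    intro k hk
    rcases Nat.lt_succ_iff_lt_or_eq.mp hk with hk | rfl
    · obtain ⟨J', b', hle, hJ', hb', hreg⟩ := ih k hk
      exact ⟨J', b', hle.trans le_sup_left, hJ', Ideal.mem_sup_left hb', hreg⟩
    · exact ⟨J, b, le_sup_left, hJ, Ideal.mem_sup_right (Ideal.mem_span_singleton_self b), hb⟩

lemma EV.eq_zero [IsLocalRing R] {M : Type u} [AddCommGroup M] [Module R M] {k : ℕ}
    (h : EV M k (maximalIdeal R)) (ξ : MExt R M R k) : ξ = 0 := by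
  obtain ⟨u, hu, hξ⟩ := h ξ
  have hu' : IsUnit u := by simpa using hu
  exact (hu'.smul_eq_zero).mp hξ

lemma maximalIdeal_isPrime (R : Type u) [CommRing R] [IsLocalRing R] :
    (maximalIdeal R).IsPrime := (maximalIdeal.isMaximal R).isPrime

/-- The Ext modules of a quotient by a regular sequence. -/
lemma RegIdeal.exists_class [IsLocalRing R] {J : Ideal R} {i : ℕ} (h : RegIdeal J i) :
    (∀ k, i < k → ∀ ξ : MExt R (R ⧸ J) R k, ξ = 0) ∧ ∃ ε : MExt R (R ⧸ J) R i,
      (∀ ξ, ∃ z : R, ξ = z • ε) ∧ ∀ y : R, y • ε = 0 → y ∈ J := by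
  have hm := maximalIdeal_isPrime R
  induction h with
  | zero =>
    constructor
    · intro k hk ξ
      refine EV.eq_zero (EV.of_equiv (quotBot R).symm (EV.of_forall_eq_zero hm fun ξ => ?_)) ξ
      exact ext_self_eq_zero k hk ξ
    · refine ⟨(extZeroEquiv R (R ⧸ (⊥ : Ideal R)) R).symm (quotBot R).toLinearMap, ?_, ?_⟩
      · intro ξ
        obtain ⟨φ, rfl⟩ := (extZeroEquiv R (R ⧸ (⊥ : Ideal R)) R).symm.surjective ξ
        refine ⟨φ (Ideal.Quotient.mk ⊥ 1), ?_⟩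
        rw [← map_smul]
        congr 1
        ext
        change φ (Ideal.Quotient.mk ⊥ 1) = φ (Ideal.Quotient.mk ⊥ 1) * (1 : R)
        rw [mul_one]
      · intro y hy
        rw [← map_smul, LinearEquiv.map_eq_zero_iff] at hy
        have h1 : y * (1 : R) = 0 := congrArg (fun φ => φ (Ideal.Quotient.mk ⊥ 1)) hy
        rw [mul_one] at h1
        exact h1 ▸ Submodule.zero_mem _
  | @succ J i b hJ hb ih =>
    obtain ⟨ih₁, ε, hgen, hann⟩ := ih
    have hx : ∀ y ∈ J, b * y ∈ J := fun y hy => J.mul_mem_left _ hy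
    have hinj := quotMul_injective hx fun y hy => hb y (by rwa [mul_comm])
    have hker : Subsingleton (LinearMap.ker (quotMul J J b hx)) := by
      rw [LinearMap.ker_eq_bot.mpr hinj]
      infer_instance
    have hex := quotMul_exact hx
    have hsurj := quotMul_one_surjective (J := J) (J' := J ⊔ Ideal.span {b}) le_sup_left
    constructor
    · intro k hk
      obtain ⟨k, rfl⟩ := Nat.exists_eq_succ_of_ne_zero (Nat.ne_zero_of_lt hk)
      exact EV.eq_zero (EV.coker hm hex hsurj (EV.of_forall_eq_zero hm (ih₁ k (by omega)))
        (fun _ _ => EV.of_subsingleton hm)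
        (EV.of_forall_eq_zero hm (ih₁ (k + 1) (by omega))))
    · obtain ⟨ε', hε', hgen'⟩ := exists_class_coker hm hex hsurj
        (EV.of_subsingleton hm) ε
      refine ⟨ε', ?_, ?_⟩
      · intro ξ
        obtain ⟨u, hu, z, hz⟩ := hgen' (fun _ _ => EV.of_subsingleton hm)
          (fun ξ => by
            obtain ⟨z, hz⟩ := hgen ξ
            exact ⟨1, one_not_mem hm, z, by rw [one_smul, hz]⟩)
          (EV.of_forall_eq_zero hm (ih₁ (i + 1) (by omega))) ξ
        have hu' : IsUnit u := by simpa using hu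
        obtain ⟨v, rfl⟩ := hu'
        refine ⟨(↑v⁻¹ : R) * z, ?_⟩
        rw [mul_smul, ← hz, smul_smul, Units.inv_mul, one_smul]
      · intro y hy
        obtain ⟨v, hv, η, hη⟩ := hε' y hy
        obtain ⟨z, rfl⟩ := hgen η
        rw [pull_quotMul_self, smul_smul, ← sub_eq_zero, ← sub_smul] at hη
        refine inSat_maximalIdeal.mp ⟨v, hv, ?_⟩
        have : v * y = (v * y - b * z) + z * b := by ring
        rw [this]
        exact add_mem (Ideal.mem_sup_left (hann _ hη))
          (Ideal.mem_sup_right (Ideal.mul_mem_left _ _ (Ideal.mem_span_singleton_self b)))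

lemma push_surjective_of_equiv {M N₁ N₂ : Type u} [AddCommGroup M] [Module R M] [AddCommGroup N₁]
    [Module R N₁] [AddCommGroup N₂] [Module R N₂] (e : N₁ ≃ₗ[R] N₂) (n : ℕ) :
    Function.Surjective (push M e.toLinearMap n) := by
  intro x
  refine ⟨push M e.symm.toLinearMap n x, ?_⟩
  rw [push_apply, push_apply, Abelian.Ext.comp_assoc_of_third_deg_zero,
    Abelian.Ext.mk₀_comp_mk₀, ← ModuleCat.ofHom_comp, LinearEquiv.comp_symm, ModuleCat.ofHom_id,
    Abelian.Ext.comp_mk₀_id]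

/-- Dimension shifting along a regular sequence that kills the first argument. -/
lemma RegIdeal.exists_shift {J : Ideal R} {i : ℕ} (h : RegIdeal J i) {M : Type u} [AddCommGroup M]
    [Module R M] (hM : ∀ a ∈ J, ∀ m : M, a • m = 0) : ∀ n k, k = n + i →
    ∃ φ : MExt R M (R ⧸ J) n →ₗ[R] MExt R M R k, Function.Surjective φ := by
  induction h with
  | zero =>
    intro n k hk
    obtain rfl : n = k := by simpa using hk.symm
    exact ⟨push M (quotBot R).toLinearMap n, push_surjective_of_equiv _ _⟩
  | @succ J i b hJ hb ih =>
    intro n k hk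
    obtain ⟨φ, hφ⟩ := ih (fun a ha => hM a (Ideal.mem_sup_left ha)) (n + 1) k (by omega)
    have hx : ∀ y ∈ J, b * y ∈ J := fun y hy => J.mul_mem_left _ hy
    obtain ⟨δ, hδ⟩ := exists_connecting_push _ _
      (quotMul_injective hx fun y hy => hb y (by rwa [mul_comm])) (quotMul_exact hx)
      (quotMul_one_surjective le_sup_left) M n
    refine ⟨φ.comp δ, fun ξ => ?_⟩
    obtain ⟨η, rfl⟩ := hφ ξ
    obtain ⟨ζ, rfl⟩ := hδ η (by
      rw [quotMul_self, push_id_smul]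
      exact smul_eq_zero_of_forall_smul_eq_zero b
        (hM b (Ideal.mem_sup_right (Ideal.mem_span_singleton_self b))) _ _)
    exact ⟨ζ, rfl⟩

end Regular

section Residue

variable {R : Type u} [CommRing R] [IsLocalRing R]

lemma hom_residue_eq_zero {J : Ideal R} {b : R} (hb : b ∈ maximalIdeal R)
    (hreg : ∀ y, y * b ∈ J → y ∈ J) (ξ : MExt R (R ⧸ maximalIdeal R) (R ⧸ J) 0) : ξ = 0 := by
  obtain ⟨φ, rfl⟩ := (extZeroEquiv R (R ⧸ maximalIdeal R) (R ⧸ J)).symm.surjective ξ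
  rw [LinearEquiv.map_eq_zero_iff]
  ext
  change φ (Ideal.Quotient.mk _ 1) = 0
  obtain ⟨y, hy⟩ := Ideal.Quotient.mk_surjective (φ (Ideal.Quotient.mk _ 1))
  rw [← hy, Ideal.Quotient.eq_zero_iff_mem]
  refine hreg y ?_
  rw [mul_comm, ← Ideal.Quotient.eq_zero_iff_mem, ← smul_mk, hy, ← map_smul, smul_mk, mul_one,
    Ideal.Quotient.eq_zero_iff_mem.mpr hb, map_zero]

lemma RegIdeal.ext_residue_eq_zero {J : Ideal R} {d : ℕ} (h : RegIdeal J d)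
    (hJ : J ≤ maximalIdeal R) (k : ℕ) (hk : k < d)
    (ξ : MExt R (R ⧸ maximalIdeal R) R k) : ξ = 0 := by
  obtain ⟨J', b, hle, hJ', hb, hreg⟩ := h.exists_lt k hk
  obtain ⟨φ, hφ⟩ := hJ'.exists_shift (M := R ⧸ maximalIdeal R) (fun a ha m => by
    obtain ⟨y, rfl⟩ := Ideal.Quotient.mk_surjective m
    rw [smul_mk, Ideal.Quotient.eq_zero_iff_mem]
    exact Ideal.mul_mem_right _ _ (hJ (hle ha))) 0 k (by simp)
  obtain ⟨η, rfl⟩ := hφ ξ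
  rw [hom_residue_eq_zero (hJ hb) hreg η, map_zero]

/-- The socle of `R/J` is cyclic if `J` is irreducible. -/
lemma exists_socle_generator {J : Ideal R}
    (hirr : ∀ A B : Ideal R, A ⊓ B = J → (A = J ∨ B = J)) :
    ∃ ε : MExt R (R ⧸ maximalIdeal R) (R ⧸ J) 0, ∀ ξ, ∃ z : R, ξ = z • ε := by
  let e := extZeroEquiv R (R ⧸ maximalIdeal R) (R ⧸ J)
  suffices h : ∃ φ : (R ⧸ maximalIdeal R) →ₗ[R] (R ⧸ J), ∀ ψ, ∃ z : R, ψ = z • φ by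
    obtain ⟨φ, hφ⟩ := h
    refine ⟨e.symm φ, fun ξ => ?_⟩
    obtain ⟨z, hz⟩ := hφ (e ξ)
    exact ⟨z, by rw [← map_smul, ← hz, e.symm_apply_apply]⟩
  by_cases h0 : ∀ φ : (R ⧸ maximalIdeal R) →ₗ[R] (R ⧸ J), φ = 0
  · exact ⟨0, fun ψ => ⟨0, by rw [h0 ψ, smul_zero]⟩⟩
  push Not at h0
  obtain ⟨φ, hφ⟩ := h0
  refine ⟨φ, fun ψ => ?_⟩
  have hext : ∀ φ₁ φ₂ : (R ⧸ maximalIdeal R) →ₗ[R] (R ⧸ J),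
      φ₁ (Ideal.Quotient.mk _ 1) = φ₂ (Ideal.Quotient.mk _ 1) → φ₁ = φ₂ := by
    intro φ₁ φ₂ h
    ext
    exact h
  obtain ⟨x, hx⟩ := Ideal.Quotient.mk_surjective (φ (Ideal.Quotient.mk _ 1))
  obtain ⟨y, hy⟩ := Ideal.Quotient.mk_surjective (ψ (Ideal.Quotient.mk _ 1))
  have hxJ : x ∉ J := fun h => hφ (hext _ _ (by
    rw [← hx, Ideal.Quotient.eq_zero_iff_mem.mpr h]; rfl))
  have hsoc : ∀ b ∈ maximalIdeal R, b * y ∈ J := fun b hb => by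
    rw [← Ideal.Quotient.eq_zero_iff_mem, ← smul_mk, hy, ← map_smul, smul_mk, mul_one,
      Ideal.Quotient.eq_zero_iff_mem.mpr hb, map_zero]
  have hyx : y ∈ J ⊔ Ideal.span {x} := by
    by_contra hcon
    have hinf : (J ⊔ Ideal.span {x}) ⊓ (J ⊔ Ideal.span {y}) = J := by
      refine le_antisymm ?_ (le_inf le_sup_left le_sup_left)
      rintro w ⟨hwx, hwy⟩
      obtain ⟨j, hj, c, hc, rfl⟩ := Submodule.mem_sup.mp hwy
      obtain ⟨b, rfl⟩ := Ideal.mem_span_singleton'.mp hc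
      by_cases hb : b ∈ maximalIdeal R
      · exact add_mem hj (hsoc b hb)
      · have hb' : IsUnit b := by simpa using hb
        refine absurd ((Ideal.unit_mul_mem_iff_mem _ hb').mp ?_) hcon
        exact (Submodule.add_mem_iff_right _ (Ideal.mem_sup_left hj)).mp hwx
    rcases hirr _ _ hinf with h | h
    · exact hxJ (h ▸ Ideal.mem_sup_right (Ideal.mem_span_singleton_self x))
    · have : y ∈ J := h ▸ Ideal.mem_sup_right (Ideal.mem_span_singleton_self y)
      exact hcon (Ideal.mem_sup_left this)
  obtain ⟨j, hj, c, hc, hjc⟩ := Submodule.mem_sup.mp hyx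
  obtain ⟨z, rfl⟩ := Ideal.mem_span_singleton'.mp hc
  refine ⟨z, hext _ _ ?_⟩
  rw [LinearMap.smul_apply, ← hx, ← hy, smul_mk, Ideal.Quotient.eq, ← hjc, add_sub_cancel_right]
  exact hj

lemma length_ext_residue_le {J : Ideal R} {d : ℕ} (h : RegIdeal J d)
    (hJ : J ≤ maximalIdeal R) (hirr : ∀ A B : Ideal R, A ⊓ B = J → (A = J ∨ B = J)) :
    Module.length R (MExt R (R ⧸ maximalIdeal R) R d) ≤ 1 := by
  have hkill : ∀ a ∈ maximalIdeal R, ∀ m : R ⧸ maximalIdeal R, a • m = 0 := fun a ha m => by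
    obtain ⟨y, rfl⟩ := Ideal.Quotient.mk_surjective m
    rw [smul_mk, Ideal.Quotient.eq_zero_iff_mem]
    exact Ideal.mul_mem_right _ _ ha
  obtain ⟨φ, hφ⟩ := h.exists_shift (M := R ⧸ maximalIdeal R)
    (fun a ha => hkill a (hJ ha)) 0 d (by simp)
  obtain ⟨ε, hε⟩ := exists_socle_generator hirr
  let f : (R ⧸ maximalIdeal R) →ₗ[R] MExt R (R ⧸ maximalIdeal R) R d :=
    Submodule.liftQ _ (LinearMap.toSpanSingleton R _ (φ ε)) fun a ha => by
      rw [LinearMap.mem_ker, LinearMap.toSpanSingleton_apply]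
      exact smul_eq_zero_of_forall_smul_eq_zero a (hkill a ha) _ _
  have hf : Function.Surjective f := by
    intro ξ
    obtain ⟨η, rfl⟩ := hφ ξ
    obtain ⟨z, rfl⟩ := hε η
    exact ⟨Ideal.Quotient.mk _ z, by rw [map_smul]; rfl⟩
  have : IsSimpleModule R (R ⧸ maximalIdeal R) :=
    isSimpleModule_iff_quot_maximal.mpr ⟨_, maximalIdeal.isMaximal R, ⟨LinearEquiv.refl _ _⟩⟩
  calc Module.length R (MExt R (R ⧸ maximalIdeal R) R d)
      ≤ Module.length R (R ⧸ maximalIdeal R) := Module.length_le_of_surjective f hf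
    _ = 1 := Module.length_eq_one R _

lemma exists_equiv_residue (M : Type u) [AddCommGroup M] [Module R M] [IsSimpleModule R M] :
    Nonempty (M ≃ₗ[R] R ⧸ maximalIdeal R) := by
  obtain ⟨m, hm, ⟨e⟩⟩ := isSimpleModule_iff_quot_maximal.mp (inferInstance : IsSimpleModule R M)
  rw [IsLocalRing.eq_maximalIdeal hm] at e
  exact ⟨e⟩

lemma length_mext_le {d : ℕ} (h : Module.length R (MExt R (R ⧸ maximalIdeal R) R d) ≤ 1)
    (C : Type u) [AddCommGroup C] [Module R C] (hC : IsFiniteLength R C) :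
    Module.length R (MExt R C R d) ≤ Module.length R C := by
  induction hC with
  | @of_subsingleton C _ _ _ =>
    have : Subsingleton (MExt R C R d) := by
      refine subsingleton_of_forall_eq 0 fun ξ => ?_
      exact (EV.of_subsingleton (maximalIdeal_isPrime R)).eq_zero ξ
    rw [Module.length_eq_zero]
    exact zero_le
  | @of_simple_quotient C _ _ N hs _ ih =>
    obtain ⟨e⟩ := exists_equiv_residue (R := R) (C ⧸ N)
    have h1 : Module.length R (MExt R (C ⧸ N) R d) ≤ 1 := by
      refine (Module.length_le_of_surjective (pull e.toLinearMap R d) fun ξ => ?_).trans h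
      exact ⟨pull e.symm.toLinearMap R d ξ, by rw [← pull_comp, LinearEquiv.symm_comp, pull_id]⟩
    have hex : Function.Exact N.subtype N.mkQ := LinearMap.exact_subtype_mkQ N
    have h2 := Module.length_eq_add_of_exact N.subtype N.mkQ N.injective_subtype
      N.mkQ_surjective hex
    have h3 := Module.length_eq_add_of_exact (LinearMap.range (pull N.mkQ R d)).subtype
      (pull N.subtype R d).rangeRestrict (LinearMap.range (pull N.mkQ R d)).injective_subtype
      (pull N.subtype R d).surjective_rangeRestrict (by
        intro x
        constructor
        · intro hx
          obtain ⟨y, rfl⟩ := pull_exact _ _ N.injective_subtype hex N.mkQ_surjective d x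
            (by simpa using congrArg Subtype.val hx)
          exact ⟨⟨_, y, rfl⟩, rfl⟩
        · rintro ⟨⟨_, y, rfl⟩, rfl⟩
          refine Subtype.ext ?_
          change pull N.subtype R d (pull N.mkQ R d y) = 0
          rw [← pull_comp, hex.linearMap_comp_eq_zero, pull_zero])
    rw [h2, h3, Module.length_eq_one R (C ⧸ N), add_comm]
    refine add_le_add ?_ ?_
    · exact (Module.length_le_of_injective _ (Submodule.injective_subtype _)).trans ih
    · exact (Module.length_le_of_surjective _ (pull N.mkQ R d).surjective_rangeRestrict).trans h1

lemma ext_eq_zero_of_isFiniteLength {k : ℕ} (h : ∀ ξ : MExt R (R ⧸ maximalIdeal R) R k, ξ = 0)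
    (C : Type u) [AddCommGroup C] [Module R C] (hC : IsFiniteLength R C) :
    ∀ ξ : MExt R C R k, ξ = 0 := by
  have hm := maximalIdeal_isPrime R
  induction hC with
  | of_subsingleton => exact (EV.of_subsingleton hm).eq_zero
  | @of_simple_quotient C _ _ N hs _ ih =>
    obtain ⟨e⟩ := exists_equiv_residue (R := R) (C ⧸ N)
    exact (EV.mid hm N.injective_subtype (LinearMap.exact_subtype_mkQ N) N.mkQ_surjective
      (EV.of_forall_eq_zero hm ih)
      (EV.of_equiv e.symm (EV.of_forall_eq_zero hm h))).eq_zero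

end Residue

section InjectiveDimension

variable {R : Type u} [CommRing R] [IsLocalRing R] [IsNoetherianRing R]

lemma isArtinian_of_primes {J : Ideal R}
    (hJ : ∀ q : Ideal R, q.IsPrime → J ≤ q → q = maximalIdeal R)
    (M : Type u) [AddCommGroup M] [Module R M] [hM : Module.Finite R M]
    (hJM : ∀ a ∈ J, ∀ m : M, a • m = 0) : IsArtinian R M := by
  refine IsNoetherianRing.induction_on_isQuotientEquivQuotientPrime R hM
    (motive := fun N _ _ _ => (∀ a ∈ J, ∀ m : N, a • m = 0) → IsArtinian R N) ?_ ?_ ?_ hJM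
  · intro N _ _ _ _ _
    infer_instance
  · intro N _ _ _ q e hN
    have hq : q.1 = maximalIdeal R := hJ q.1 q.2 fun a ha => by
      have := congrArg e (hN a ha (e.symm (Ideal.Quotient.mk _ 1)))
      rwa [map_smul, e.apply_symm_apply, map_zero, smul_mk, mul_one,
        Ideal.Quotient.eq_zero_iff_mem] at this
    have : IsSimpleModule R N := isSimpleModule_iff_quot_maximal.mpr
      ⟨q.1, hq ▸ maximalIdeal.isMaximal R, ⟨e⟩⟩
    infer_instance
  · intro N₁ _ _ _ N₂ _ _ _ N₃ _ _ _ f g hf hg hfg h₁ h₃ hN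
    have := h₁ fun a ha m => hf (by rw [map_smul, hN a ha, map_zero])
    have := h₃ fun a ha m => by
      obtain ⟨m, rfl⟩ := hg m
      rw [← map_smul, hN a ha, map_zero]
    exact isArtinian_of_range_eq_ker f g hfg.linearMap_ker_eq.symm

lemma eq_maximalIdeal_of_height {J : Ideal R} {d : ℕ} (h : RegIdeal J d)
    (hd : (maximalIdeal R).height = d) (q : Ideal R) (hq : q.IsPrime) (hJ : J ≤ q) :
    q = maximalIdeal R := by
  by_contra hne
  have hlt : q < maximalIdeal R := lt_of_le_of_ne (IsLocalRing.le_maximalIdeal hq.ne_top) hne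
  have h1 := height_add_one_le hq (maximalIdeal_isPrime R) hlt
  have h2 := h.le_height q hq hJ
  rw [hd] at h1
  have h3 : ((d + 1 : ℕ) : ℕ∞) ≤ d := by
    push_cast
    exact (add_le_add_left h2 1).trans h1
  have := ENat.natCast_le_natCast.mp h3
  omega

/-- Ext of the residue field into `R` vanishes above the dimension. -/
lemma ext_residue_eq_zero_of_lt {J : Ideal R} {d : ℕ} (h : RegIdeal J d)
    (hJ : J ≤ maximalIdeal R) (hd : (maximalIdeal R).height = d)
    (hirr : ∀ A B : Ideal R, A ⊓ B = J → (A = J ∨ B = J)) :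
    ∀ k, d < k → ∀ ξ : MExt R (R ⧸ maximalIdeal R) R k, ξ = 0 := by
  have hm := maximalIdeal_isPrime R
  obtain ⟨hvan, ε, hgen, hann⟩ := h.exists_class
  have hle := length_ext_residue_le h hJ hirr
  have hart : IsArtinian R (R ⧸ J) :=
    isArtinian_of_primes (eq_maximalIdeal_of_height h hd) _ (smul_quotient_eq_zero J)
  have hsurj := quotMul_one_surjective hJ
  let g := quotMul J (maximalIdeal R) 1 (one_mul_mem_of_le hJ)
  let A := LinearMap.ker g
  have hex : Function.Exact A.subtype g := LinearMap.exact_subtype_ker_map g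
  have hfl : IsFiniteLength R A := isFiniteLength_iff_isNoetherian_isArtinian.mpr
    ⟨inferInstance, inferInstance⟩
  have hAfin : Module.length R A ≠ ⊤ := Module.length_ne_top_iff.mpr hfl
  have hsimple : IsSimpleModule R (R ⧸ maximalIdeal R) :=
    isSimpleModule_iff_quot_maximal.mpr ⟨_, maximalIdeal.isMaximal R, ⟨LinearEquiv.refl _ _⟩⟩
  let α := pull A.subtype R d
  have hlen₁ : Module.length R (R ⧸ J) = Module.length R A + 1 := by
    rw [Module.length_eq_add_of_exact A.subtype g A.injective_subtype hsurj hex,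
      Module.length_eq_one R (R ⧸ maximalIdeal R)]
  have hlen₂ : Module.length R (R ⧸ J) ≤ Module.length R (MExt R (R ⧸ J) R d) := by
    let f : (R ⧸ J) →ₗ[R] MExt R (R ⧸ J) R d :=
      Submodule.liftQ _ (LinearMap.toSpanSingleton R _ ε) fun a ha => by
        rw [LinearMap.mem_ker, LinearMap.toSpanSingleton_apply]
        exact smul_eq_zero_of_forall_smul_eq_zero a (smul_quotient_eq_zero J a ha) _ _
    refine Module.length_le_of_injective f ?_
    rw [injective_iff_map_eq_zero]
    intro x hx
    obtain ⟨y, rfl⟩ := Ideal.Quotient.mk_surjective x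
    exact Ideal.Quotient.eq_zero_iff_mem.mpr (hann y hx)
  have hker : LinearMap.ker α = LinearMap.range (pull g R d) := by
    ext x
    constructor
    · intro hx
      obtain ⟨y, rfl⟩ := pull_exact _ _ A.injective_subtype hex hsurj d x hx
      exact ⟨y, rfl⟩
    · rintro ⟨y, rfl⟩
      rw [LinearMap.mem_ker, ← pull_comp, hex.linearMap_comp_eq_zero, pull_zero]
  have hlen₃ : Module.length R (MExt R (R ⧸ J) R d) ≤ 1 + Module.length R (LinearMap.range α) := by
    rw [Module.length_eq_add_of_exact (LinearMap.ker α).subtype α.rangeRestrict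
      (LinearMap.ker α).injective_subtype α.surjective_rangeRestrict (exact_ker_rangeRestrict α),
      hker]
    gcongr
    exact (Module.length_le_of_surjective _ (pull g R d).surjective_rangeRestrict).trans hle
  have hlen₄ := length_mext_le hle A hfl
  have hlen₅ := Module.length_eq_add_of_exact (LinearMap.range α).subtype (LinearMap.range α).mkQ
    (LinearMap.range α).injective_subtype (LinearMap.range α).mkQ_surjective
    (LinearMap.exact_subtype_mkQ _)
  have hαsurj : Function.Surjective α := by
    rw [← LinearMap.range_eq_top, ← Submodule.Quotient.subsingleton_iff,
      ← Module.length_eq_zero_iff (R := R)]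
    rw [hlen₅] at hlen₄
    have hlen₆ := (hlen₁ ▸ hlen₂).trans hlen₃
    generalize Module.length R A = a at *
    generalize Module.length R (LinearMap.range α) = b at *
    generalize Module.length R (MExt R A R d ⧸ LinearMap.range α) = c at *
    clear * - hAfin hlen₄ hlen₆
    lift a to ℕ using hAfin
    have hb : b ≠ ⊤ := ne_top_of_le_ne_top (ENat.natCast_ne_top a) (le_self_add.trans hlen₄)
    lift b to ℕ using hb
    have hc : c ≠ ⊤ := ne_top_of_le_ne_top (ENat.natCast_ne_top a) (le_add_self.trans hlen₄)
    lift c to ℕ using hc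
    norm_cast at *
    omega
  have hbase : ∀ ξ : MExt R (R ⧸ maximalIdeal R) R (d + 1), ξ = 0 := by
    intro ξ
    obtain ⟨δ, hδ, -, -, hδ'⟩ := exists_connecting _ _ A.injective_subtype hex hsurj R d
    obtain ⟨y, rfl⟩ := hδ' ξ (hvan _ (by omega) _)
    obtain ⟨x, rfl⟩ := hαsurj y
    exact hδ x
  intro k hk
  induction k, hk using Nat.le_induction with
  | base => exact hbase
  | succ k hk ih =>
    exact (EV.right hm A.injective_subtype hex hsurj
      (EV.of_forall_eq_zero hm (ext_eq_zero_of_isFiniteLength ih A hfl))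
      (EV.of_forall_eq_zero hm (hvan (k + 1) (by omega)))).eq_zero

variable (R) in
/-- The vanishing properties of Ext into a Gorenstein local ring: finite injective dimension
and vanishing below the height. -/
def ExtGorenstein : Prop :=
  (∃ d : ℕ, ∀ q : Ideal R, q.IsPrime → ∀ k, d < k → EV (R ⧸ q) k (maximalIdeal R)) ∧
    ∀ q : Ideal R, q.IsPrime → ∀ k : ℕ, (k : ℕ∞) < q.height → EV (R ⧸ q) k (maximalIdeal R)

lemma extGorenstein_of_isGorensteinLocalRing (h : IsGorensteinLocalRing R) : ExtGorenstein R := by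
  have hm := maximalIdeal_isPrime R
  obtain ⟨-, l, hl, hreg, hlen, hirr⟩ := h
  have hJ := regIdeal_of_isWeaklyRegular hreg.toIsWeaklyRegular
  have hJm : Ideal.ofList l ≤ maximalIdeal R := Ideal.span_le.mpr fun x hx => hl x hx
  have hd : (maximalIdeal R).height = l.length := by
    have h1 := IsLocalRing.maximalIdeal_height_eq_ringKrullDim (R := R)
    rw [← hlen] at h1
    exact_mod_cast h1
  have aux : ∀ P : Ideal R → ℕ → Prop,
      (∀ q q' : Ideal R, q.IsPrime → q'.IsPrime → q < q' → ∀ k, P q k → P q' (k + 1)) →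
      (∀ k, P (maximalIdeal R) k → EV (R ⧸ maximalIdeal R) k (maximalIdeal R)) →
      ∀ q : Ideal R, q.IsPrime → ∀ k, P q k → EV (R ⧸ q) k (maximalIdeal R) := by
    intro P hP hPm q
    induction q using WellFoundedGT.induction with
    | ind q ih =>
      intro hq k hk
      by_cases hqm : q = maximalIdeal R
      · subst hqm
        exact hPm k hk
      obtain ⟨x, hxm, hxq⟩ := SetLike.exists_of_lt
        (lt_of_le_of_ne (IsLocalRing.le_maximalIdeal hq.ne_top) hqm)
      exact EV.of_larger hq hm hxm hxq fun q' hq' hlt _ =>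
        ih q' hlt hq' (k + 1) (hP q q' hq hq' hlt k hk)
  refine ⟨⟨l.length, aux (fun _ k => l.length < k) (fun _ _ _ _ _ k hk => by omega) fun k hk =>
    EV.of_forall_eq_zero hm (ext_residue_eq_zero_of_lt hJ hJm hd hirr k hk)⟩,
    aux (fun q k => (k : ℕ∞) < q.height) ?_ fun k hk => ?_⟩
  · intro q q' hq hq' hlt k hk
    have h1 := height_add_one_le hq hq' hlt
    obtain ⟨e, he⟩ := exists_height_eq hq
    refine lt_of_lt_of_le ?_ h1
    rw [he] at hk ⊢
    norm_cast at *
    omega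
  · rw [hd] at hk
    exact EV.of_forall_eq_zero hm (hJ.ext_residue_eq_zero hJm k (by exact_mod_cast hk))

end InjectiveDimension

section GorensteinConsequences

variable {R : Type u} [CommRing R] [IsLocalRing R]

lemma ExtGorenstein.ev (hE : ExtGorenstein R) {p q : Ideal R} (hp : p.IsPrime) (hq : q.IsPrime)
    {k : ℕ} (hk : (k : ℕ∞) < q.height) : EV (R ⧸ q) k p :=
  (hE.2 q hq k hk).mono (IsLocalRing.le_maximalIdeal hp.ne_top)

lemma not_ev_of_assp {J q : Ideal R} {i : ℕ} (hJ : RegIdeal J i) (hq : Assp J q) :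
    ¬ EV (R ⧸ q) i q := by
  intro hEV
  obtain ⟨hqp, y, hy⟩ := hq
  obtain ⟨-, ε, -, hann⟩ := hJ.exists_class
  have hy' : ∀ w ∈ q, y * w ∈ J := fun w hw => by rw [mul_comm]; exact (hy w).mpr hw
  obtain ⟨u, hu, hξ⟩ := hEV (pull (quotMul q J y hy') R i ε)
  rw [← map_smul] at hξ
  obtain ⟨η, hη⟩ := pull_exact _ _ (quotMul_injective hy' fun w hw =>
    (hy w).mp (by rwa [mul_comm])) (quotMul_exact hy') (quotMul_one_surjective le_sup_left) i _ hξ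
  have hkill : y • η = 0 := smul_eq_zero_of_forall_smul_eq_zero y
    (smul_quotient_eq_zero _ y (Ideal.mem_sup_right (Ideal.mem_span_singleton_self y))) i η
  refine hu ((hy u).mp (hann _ ?_))
  rw [mul_comm, mul_smul, ← hη, ← map_smul, hkill, map_zero]

lemma ExtGorenstein.height_le_of_assp (hE : ExtGorenstein R) {J q : Ideal R} {i : ℕ}
    (hJ : RegIdeal J i) (hq : Assp J q) : q.height ≤ i :=
  le_of_not_gt fun h => not_ev_of_assp hJ hq (hE.ev hq.1 hq.1 h)

variable [IsNoetherianRing R]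

/-- Ext vanishes below the codimension of the support. -/
lemma ExtGorenstein.ev_of_support (hE : ExtGorenstein R) {p : Ideal R} (hp : p.IsPrime) {k : ℕ}
    (N : Type u) [AddCommGroup N] [Module R N] [hN : Module.Finite R N]
    (h : ∀ q : Ideal R, q.IsPrime → q ≤ p → q.height ≤ k → LZ N q) : EV N k p := by
  refine IsNoetherianRing.induction_on_isQuotientEquivQuotientPrime R hN
    (motive := fun N _ _ _ =>
      (∀ q : Ideal R, q.IsPrime → q ≤ p → q.height ≤ k → LZ N q) → EV N k p) ?_ ?_ ?_ h
  · intro N _ _ _ _ _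
    exact EV.of_subsingleton hp
  · intro N _ _ _ q e hN
    refine EV.of_equiv e.symm ?_
    by_cases hqp : q.1 ≤ p
    · refine hE.ev hp q.2 (lt_of_not_ge fun hk => ?_)
      obtain ⟨u, hu, hu'⟩ := hN q.1 q.2 hqp hk (e.symm (Ideal.Quotient.mk _ 1))
      have := congrArg e hu'
      rw [map_smul, e.apply_symm_apply, map_zero, smul_mk, mul_one,
        Ideal.Quotient.eq_zero_iff_mem] at this
      exact hu this
    · obtain ⟨u, huq, hup⟩ := SetLike.not_le_iff_exists.mp hqp
      exact EV.of_killed hup (smul_quotient_eq_zero _ u huq)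
  · intro N₁ _ _ _ N₂ _ _ _ N₃ _ _ _ f g hf hg hfg h₁ h₃ hN
    refine EV.mid hp hf hfg hg (h₁ fun q hq hqp hk m => ?_) (h₃ fun q hq hqp hk m => ?_)
    · obtain ⟨u, hu, hum⟩ := hN q hq hqp hk (f m)
      exact ⟨u, hu, hf (by rw [map_smul, hum, map_zero])⟩
    · obtain ⟨m, rfl⟩ := hg m
      obtain ⟨u, hu, hum⟩ := hN q hq hqp hk m
      exact ⟨u, hu, by rw [← map_smul, hum, map_zero]⟩

lemma ExtGorenstein.exists_regIdeal (hE : ExtGorenstein R) {q : Ideal R} (_hq : q.IsPrime) (i : ℕ)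
    (hi : (i : ℕ∞) ≤ q.height) : ∃ J ≤ q, RegIdeal J i := by
  induction i with
  | zero => exact ⟨⊥, bot_le, RegIdeal.zero⟩
  | succ i ih =>
    have hlt : (i : ℕ∞) < q.height := lt_of_lt_of_le (by exact_mod_cast Nat.lt_succ_self i) hi
    obtain ⟨J, hJq, hJ⟩ := ih hlt.le
    obtain ⟨b, hbq, hb⟩ := exists_regular_mem (V := J) (q := q) fun q' hq' hle =>
      absurd ((Ideal.height_mono hle).trans (hE.height_le_of_assp hJ hq')) (not_le.mpr hlt)
    exact ⟨_, sup_le hJq ((Ideal.span_singleton_le_iff_mem q).mpr hbq), hJ.succ hb⟩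

lemma ExtGorenstein.not_ev (hE : ExtGorenstein R) {q : Ideal R} (hq : q.IsPrime) {e : ℕ}
    (he : q.height = e) : ¬ EV (R ⧸ q) e q := by
  obtain ⟨J, hJq, hJ⟩ := hE.exists_regIdeal hq e he.ge
  exact not_ev_of_assp hJ (assp_of_minimal (hJ.mem_minimalPrimes hq hJq he.le))

/-- Finite injective dimension at every localization. -/
lemma ExtGorenstein.ev_of_height_lt (hE : ExtGorenstein R) {p : Ideal R} (hp : p.IsPrime) {k : ℕ}
    (hk : p.height < k) (C : Type u) [AddCommGroup C] [Module R C] [Module.Finite R C] :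
    EV C k p := by
  obtain ⟨e, he⟩ := exists_height_eq hp
  rw [he] at hk
  have hek : e < k := by exact_mod_cast hk
  obtain ⟨d, hd⟩ := hE.1
  obtain ⟨J, hJp, hJ⟩ := hE.exists_regIdeal hp e he.ge
  obtain ⟨-, y, hy⟩ := assp_of_minimal (hJ.mem_minimalPrimes hp hJp he.le)
  have key : ∀ j k, e < k → d < k + j → ∀ q : Ideal R, q.IsPrime → EV (R ⧸ q) k p := by
    intro j
    induction j with
    | zero =>
      intro k _ hdk q hq
      exact (hd q hq k hdk).mono (IsLocalRing.le_maximalIdeal hp.ne_top)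
    | succ j ih =>
      intro k hek hdk q hq
      have hsucc : ∀ q : Ideal R, q.IsPrime → EV (R ⧸ q) (k + 1) p :=
        ih (k + 1) (by omega) (by omega)
      by_cases hqp : p ≤ q
      · rcases hqp.lt_or_eq with hlt | rfl
        · obtain ⟨u, huq, hup⟩ := SetLike.exists_of_lt hlt
          exact EV.of_killed hup (smul_quotient_eq_zero _ u huq)
        · have hy' : ∀ w ∈ p, y * w ∈ J := fun w hw => by rw [mul_comm]; exact (hy w).mpr hw
          exact EV.left hp (quotMul_injective hy' fun w hw =>
            (hy w).mp (by rwa [mul_comm])) (quotMul_exact hy')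
            (quotMul_one_surjective le_sup_left)
            (EV.of_forall_eq_zero hp (hJ.exists_class.1 k hek))
            (devissage (J := ⊥) hp (fun q hq _ => hsucc q hq) _ (by simp))
      · obtain ⟨x, hxp, hxq⟩ := SetLike.not_le_iff_exists.mp hqp
        exact EV.of_larger hq hp hxp hxq fun q' hq' _ _ => hsucc q' hq'
  exact devissage (J := ⊥) hp (fun q hq _ => key (d + 1) k hek (by omega) q hq) C (by simp)

/-- If `Ext^e(M, R)` vanishes at a prime of height `e`, then `M` has depth positive there. -/
lemma ExtGorenstein.eq_zero_of_socle (hE : ExtGorenstein R) {q : Ideal R} (hq : q.IsPrime) {e : ℕ}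
    (he : q.height = e) {M : Type u} [AddCommGroup M] [Module R M] [Module.Finite R M]
    (hM : EV M e q) (m : M) (hm : ∀ z ∈ q, ∃ u, u ∉ q ∧ u • z • m = 0) :
    ∃ u, u ∉ q ∧ u • m = 0 := by
  by_contra hcon
  push Not at hcon
  have hLZ : LZ (Submodule.map (LinearMap.toSpanSingleton R M m) q) q := by
    rintro ⟨_, z, hz, rfl⟩
    obtain ⟨u, hu, h⟩ := hm z hz
    exact ⟨u, hu, Subtype.ext h⟩
  obtain ⟨u, hu, hkill⟩ := hLZ.exists_killed hq
  let f : (R ⧸ q) →ₗ[R] M := Submodule.liftQ q (LinearMap.toSpanSingleton R M (u • m))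
    fun z hz => by
      rw [LinearMap.mem_ker, LinearMap.toSpanSingleton_apply, smul_comm]
      exact congrArg Subtype.val (hkill ⟨_, z, hz, rfl⟩)
  have hf : Function.Injective f := by
    rw [injective_iff_map_eq_zero]
    intro x hx
    obtain ⟨w, rfl⟩ := Ideal.Quotient.mk_surjective x
    rw [Ideal.Quotient.eq_zero_iff_mem]
    by_contra hw
    refine hcon (w * u) (not_mem_mul hq hw hu) ?_
    rw [mul_smul]
    exact hx
  refine hE.not_ev hq he (EV.left hq hf (LinearMap.exact_map_mkQ_range f)
    (LinearMap.range f).mkQ_surjective hM (hE.ev_of_height_lt hq ?_ _))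
  rw [he]
  exact_mod_cast Nat.lt_succ_self e

/-- Adjacent primes differ in height by at most one. -/
lemma ExtGorenstein.exists_between (hE : ExtGorenstein R) {q₀ q : Ideal R} (hq₀ : q₀.IsPrime)
    (hq : q.IsPrime) (hle : q₀ ≤ q) {e : ℕ} (he : q₀.height = e)
    (hht : ((e + 2 : ℕ) : ℕ∞) ≤ q.height) : ∃ q₁ : Ideal R, q₁.IsPrime ∧ q₀ < q₁ ∧ q₁ < q := by
  by_contra hcon
  push Not at hcon
  have hne : q₀ ≠ q := by
    rintro rfl
    rw [he] at hht
    have := ENat.natCast_le_natCast.mp hht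
    omega
  obtain ⟨x, hxq, hxq₀⟩ := SetLike.exists_of_lt (lt_of_le_of_ne hle hne)
  refine hE.not_ev hq₀ he ((EV.of_larger hq₀ hq hxq hxq₀ fun q' hq' hlt _ => ?_).mono hle)
  by_cases hq'q : q' ≤ q
  · rcases hq'q.lt_or_eq with h | rfl
    · exact absurd h (hcon q' hq' hlt)
    · exact hE.ev hq hq' (lt_of_lt_of_le (by exact_mod_cast Nat.lt_succ_self (e + 1)) hht)
  · obtain ⟨u, huq', huq⟩ := SetLike.not_le_iff_exists.mp hq'q
    exact EV.of_killed huq (smul_quotient_eq_zero _ u huq')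

end GorensteinConsequences

/-! ### General generators -/

section Saturation

variable {R : Type u} [CommRing R] {p J J' 𝔞 A : Ideal R}

lemma InSat.of_mem (hp : p.IsPrime) {y : R} (h : y ∈ J) : InSat p J y :=
  ⟨1, one_not_mem hp, by rwa [one_mul]⟩

lemma InSat.add (hp : p.IsPrime) {x y : R} (hx : InSat p J x) (hy : InSat p J y) :
    InSat p J (x + y) := by
  obtain ⟨u, hu, hx⟩ := hx
  obtain ⟨v, hv, hy⟩ := hy
  refine ⟨u * v, not_mem_mul hp hu hv, ?_⟩
  rw [show u * v * (x + y) = v * (u * x) + u * (v * y) by ring]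
  exact J.add_mem (J.mul_mem_left _ hx) (J.mul_mem_left _ hy)

lemma InSat.mul_left {y : R} (r : R) (h : InSat p J y) : InSat p J (r * y) := by
  obtain ⟨u, hu, hy⟩ := h
  refine ⟨u, hu, ?_⟩
  rw [mul_left_comm]
  exact J.mul_mem_left _ hy

lemma InSat.of_mul (hp : p.IsPrime) {u y : R} (hu : u ∉ p) (h : InSat p J (u * y)) :
    InSat p J y := by
  obtain ⟨v, hv, hy⟩ := h
  exact ⟨v * u, not_mem_mul hp hv hu, by rwa [mul_assoc]⟩

lemma InSat.mono (hJ : J ≤ J') {y : R} (h : InSat p J y) : InSat p J' y :=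
  let ⟨u, hu, hy⟩ := h
  ⟨u, hu, hJ hy⟩

lemma InSat.sub (hp : p.IsPrime) {x y : R} (hx : InSat p J x) (hy : InSat p J y) :
    InSat p J (x - y) := by
  have := hx.add hp (hy.mul_left (-1))
  rwa [neg_one_mul, ← sub_eq_add_neg] at this

lemma exists_uniform [IsNoetherianRing R] (hp : p.IsPrime) (h : ∀ y ∈ 𝔞, InSat p J y) :
    ∃ u, u ∉ p ∧ ∀ y ∈ 𝔞, u * y ∈ J := by
  have hLZ : LZ (Submodule.map (Submodule.mkQ J) 𝔞) p := by
    rintro ⟨_, y, hy, rfl⟩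
    obtain ⟨u, hu, h⟩ := h y hy
    exact ⟨u, hu, Subtype.ext (Ideal.Quotient.eq_zero_iff_mem.mpr h)⟩
  obtain ⟨u, hu, hkill⟩ := hLZ.exists_killed hp
  exact ⟨u, hu, fun y hy =>
    Ideal.Quotient.eq_zero_iff_mem.mp (congrArg Subtype.val (hkill ⟨_, y, hy, rfl⟩))⟩

/-- Nakayama's lemma for saturated submodules. -/
lemma exists_smul_mem_of_sub_mem [IsNoetherianRing R] {M : Type u} [AddCommGroup M] [Module R M]
    [Module.Finite R M] (hp : p.IsPrime) (N : Submodule R M)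
    (h : ∀ m : M, ∃ u, u ∉ p ∧ ∃ z ∈ p • (⊤ : Submodule R M), u • m - z ∈ N) (m : M) :
    ∃ u, u ∉ p ∧ u • m ∈ N := by
  have hLZ : LZ (M ⧸ N) p := by
    refine LZ.of_le_smul hp le_rfl fun ξ => ?_
    obtain ⟨m, rfl⟩ := N.mkQ_surjective ξ
    obtain ⟨u, hu, z, hz, hmz⟩ := h m
    refine ⟨u, hu, ?_⟩
    have heq : u • N.mkQ m = N.mkQ z := by
      rw [← map_smul, Submodule.mkQ_apply, Submodule.mkQ_apply, Submodule.Quotient.eq]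
      exact hmz
    have hmem : N.mkQ z ∈ Submodule.map N.mkQ (p • ⊤) := Submodule.mem_map_of_mem hz
    rw [Submodule.map_smul''] at hmem
    rw [heq]
    exact Submodule.smul_mono le_rfl le_top hmem
  obtain ⟨u, hu, hum⟩ := hLZ (N.mkQ m)
  rw [← map_smul, Submodule.mkQ_apply, Submodule.Quotient.mk_eq_zero] at hum
  exact ⟨u, hu, hum⟩

/-- Nakayama's lemma for saturations. -/
lemma inSat_of_mul_sup [IsNoetherianRing R] (hp : p.IsPrime)
    (h : ∀ y ∈ 𝔞, InSat p (A ⊔ p * 𝔞) y) (y : R) (hy : y ∈ 𝔞) : InSat p A y := by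
  refine exists_smul_mem_of_sub_mem hp (Submodule.comap 𝔞.subtype A) (fun m => ?_) ⟨y, hy⟩
  obtain ⟨u, hu, huy⟩ := h m.1 m.2
  obtain ⟨a, ha, z, hz, haz⟩ := Submodule.mem_sup.mp huy
  refine ⟨u, hu, ⟨z, Ideal.mul_le_right hz⟩, (Submodule.mem_smul_top_iff _ _ _).mpr hz, ?_⟩
  change u * m.1 - z ∈ A
  rwa [← haz, add_sub_cancel_right]

lemma exists_avoid {c : R} {L : Ideal R} (h𝔞 : 𝔞 = A ⊔ (Ideal.span {c} ⊔ L)) :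
    ∀ (n : ℕ) (X : Finset (Ideal R)), X.card = n → (∀ p ∈ X, p.IsPrime) →
      (∀ p ∈ X, ¬ ∀ y ∈ 𝔞, InSat p (A ⊔ p * 𝔞) y) →
      ∃ b, b - c ∈ L ∧ ∀ p ∈ X, ¬ InSat p (A ⊔ p * 𝔞) b := by
  classical
  intro n
  have hL𝔞 : L ≤ 𝔞 := h𝔞 ▸ le_sup_right.trans le_sup_right
  induction n with
  | zero =>
    intro X hX _ _
    rw [Finset.card_eq_zero] at hX
    subst hX
    exact ⟨c, by simp, by simp⟩
  | succ n ih =>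
    intro X hX hprime hnot
    obtain ⟨p, hpX, hmin⟩ := X.exists_minimal (Finset.card_pos.mp (by omega))
    have hp := hprime p hpX
    obtain ⟨b, hb, hbX⟩ := ih (X.erase p) (by rw [Finset.card_erase_of_mem hpX]; omega)
      (fun q hq => hprime q (Finset.mem_of_mem_erase hq))
      (fun q hq => hnot q (Finset.mem_of_mem_erase hq))
    by_cases hbp : InSat p (A ⊔ p * 𝔞) b
    · obtain ⟨z, hzL, hz⟩ : ∃ z ∈ L, ¬ InSat p (A ⊔ p * 𝔞) z := by
        by_contra hcon
        push Not at hcon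
        refine hnot p hpX fun y hy => ?_
        rw [h𝔞] at hy
        obtain ⟨a, ha, w, hw, rfl⟩ := Submodule.mem_sup.mp hy
        obtain ⟨c', hc', l, hl, rfl⟩ := Submodule.mem_sup.mp hw
        obtain ⟨t, rfl⟩ := Ideal.mem_span_singleton'.mp hc'
        refine (InSat.of_mem hp (Ideal.mem_sup_left ha)).add hp
          (InSat.add hp (InSat.mul_left t ?_) (hcon l hl))
        have := hbp.sub hp (hcon _ hb)
        rwa [sub_sub_cancel] at this
      obtain ⟨r, hr, hrp⟩ := SetLike.not_le_iff_exists.mp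
        (show ¬ (X.erase p).prod id ≤ p from fun hle => by
          obtain ⟨q, hq, hqp⟩ := hp.prod_le.mp hle
          have := hmin (Finset.mem_of_mem_erase hq) hqp
          exact Finset.ne_of_mem_erase hq (le_antisymm hqp this))
      refine ⟨b + r * z, ?_, fun q hq hcon => ?_⟩
      · rw [add_sub_right_comm]
        exact L.add_mem hb (L.mul_mem_left _ hzL)
      · by_cases hqp : q = p
        · subst hqp
          refine hz (InSat.of_mul hp hrp ?_)
          have := hcon.sub hp hbp
          rwa [add_sub_cancel_left] at this
        · have hqe : q ∈ X.erase p := Finset.mem_erase.mpr ⟨hqp, hq⟩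
          have hrq : r ∈ q := (Finset.inf_le (f := id) hqe) (Ideal.prod_le_inf hr)
          refine hbX q hqe ?_
          have := hcon.sub (hprime q hq) (InSat.of_mem (hprime q hq)
            (Ideal.mem_sup_right (Ideal.mul_mem_mul hrq (hL𝔞 hzL))))
          rwa [add_sub_cancel_right] at this
    · refine ⟨b, hb, fun q hq => ?_⟩
      by_cases hqp : q = p
      · exact hqp ▸ hbp
      · exact hbX q (Finset.mem_erase.mpr ⟨hqp, hq⟩)

end Saturation

section Generators

variable {R : Type u} [CommRing R]

/-- The ideal `𝔞` is generated locally at `p` by `A` and `r` further elements of `𝔞`. -/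
def GenBy (A 𝔞 p : Ideal R) (r : ℕ) : Prop :=
  ∃ F : Finset R, F.card ≤ r ∧ (∀ x ∈ F, x ∈ 𝔞) ∧
    ∃ u, u ∉ p ∧ ∀ y ∈ 𝔞, u * y ∈ A ⊔ Ideal.span (F : Set R)

variable {A 𝔞 p : Ideal R}

lemma GenBy.mono {A' : Ideal R} {r : ℕ} (hA : A ≤ A') (h : GenBy A 𝔞 p r) : GenBy A' 𝔞 p r := by
  obtain ⟨F, hF, hF𝔞, u, hu, h⟩ := h
  exact ⟨F, hF, hF𝔞, u, hu, fun y hy => sup_le_sup_right hA _ (h y hy)⟩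

lemma GenBy.of_inSat [IsNoetherianRing R] (hp : p.IsPrime) (r : ℕ)
    (h : ∀ y ∈ 𝔞, InSat p A y) : GenBy A 𝔞 p r := by
  obtain ⟨u, hu, h⟩ := exists_uniform hp h
  exact ⟨∅, by simp, by simp, u, hu, fun y hy => Ideal.mem_sup_left (h y hy)⟩

/-- Passing to a basic element lowers the number of generators. -/
lemma GenBy.exchange (hp : p.IsPrime) {r : ℕ} (h : GenBy A 𝔞 p (r + 1)) {b : R} (hb : b ∈ 𝔞)
    (hbas : ¬ InSat p (A ⊔ p * 𝔞) b) : GenBy (A ⊔ Ideal.span {b}) 𝔞 p r := by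
  classical
  obtain ⟨F, hF, hF𝔞, u, hu, h⟩ := h
  obtain ⟨a, ha, z, hz, haz⟩ := Submodule.mem_sup.mp (h b hb)
  obtain ⟨c, -, hc⟩ := Submodule.mem_span_finset.mp hz
  obtain ⟨x, hxF, hcx⟩ : ∃ x ∈ F, c x ∉ p := by
    by_contra hcon
    push Not at hcon
    refine hbas ⟨u, hu, ?_⟩
    rw [← haz, ← hc]
    exact add_mem (Ideal.mem_sup_left ha) (Ideal.mem_sup_right (Ideal.sum_mem _ fun x hx =>
      Ideal.mul_mem_mul (hcon x hx) (hF𝔞 x hx)))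
  let B := A ⊔ Ideal.span {b} ⊔ Ideal.span ((F.erase x : Finset R) : Set R)
  have hAB : A ≤ B := le_sup_left.trans le_sup_left
  have hbB : b ∈ B := Ideal.mem_sup_left (Ideal.mem_sup_right (Ideal.mem_span_singleton_self b))
  have hFB : ∀ y ∈ F.erase x, y ∈ B := fun y hy =>
    Ideal.mem_sup_right (Ideal.subset_span (Finset.mem_coe.mpr hy))
  have hxB : c x * x ∈ B := by
    have h1 : c x * x = u * b - a - ∑ y ∈ F.erase x, c y * y := by
      rw [← haz, ← hc, ← Finset.add_sum_erase F _ hxF, smul_eq_mul]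
      simp only [smul_eq_mul]
      ring
    rw [h1]
    exact B.sub_mem (B.sub_mem (B.mul_mem_left _ hbB) (hAB ha))
      (B.sum_mem fun y hy => B.mul_mem_left _ (hFB y hy))
  have hle : ∀ w ∈ A ⊔ Ideal.span (F : Set R), c x * w ∈ B := by
    intro w hw
    obtain ⟨a', ha', z', hz', rfl⟩ := Submodule.mem_sup.mp hw
    obtain ⟨c', -, rfl⟩ := Submodule.mem_span_finset.mp hz'
    rw [mul_add, Finset.mul_sum]
    refine B.add_mem (B.mul_mem_left _ (hAB ha')) (B.sum_mem fun y hy => ?_)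
    rw [smul_eq_mul, mul_left_comm]
    refine B.mul_mem_left _ ?_
    by_cases hyx : y = x
    · exact hyx ▸ hxB
    · exact B.mul_mem_left _ (hFB y (Finset.mem_erase.mpr ⟨hyx, hy⟩))
  refine ⟨F.erase x, ?_, fun y hy => hF𝔞 y (Finset.mem_of_mem_erase hy), c x * u,
    not_mem_mul hp hcx hu, fun y hy => ?_⟩
  · rw [Finset.card_erase_of_mem hxF]
    omega
  · rw [mul_assoc]
    exact hle _ (h y hy)

/-- The ideal defining the locus where `𝔞` is not generated by `A` and `r` further elements. -/
def genLocus (A 𝔞 : Ideal R) (r : ℕ) : Ideal R :=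
  Ideal.span {u | ∃ F : Finset R, F.card ≤ r ∧ (∀ x ∈ F, x ∈ 𝔞) ∧
    ∀ y ∈ 𝔞, u * y ∈ A ⊔ Ideal.span (F : Set R)}

lemma genLocus_le_iff {r : ℕ} : genLocus A 𝔞 r ≤ p ↔ ¬ GenBy A 𝔞 p r := by
  rw [genLocus, Ideal.span_le]
  constructor
  · rintro h ⟨F, hF, hF𝔞, u, hu, hy⟩
    exact hu (h ⟨F, hF, hF𝔞, hy⟩)
  · rintro h u ⟨F, hF, hF𝔞, hy⟩
    by_contra hu
    exact h ⟨F, hF, hF𝔞, u, hu, hy⟩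

/-- The generation and codimension conditions satisfied by `i` general elements of `𝔞`. -/
structure GeneralPosition (I 𝔞 : Ideal R) (s : ℕ) (A : Ideal R) (i : ℕ) : Prop where
  gen : ∀ p : Ideal R, p.IsPrime → I ≤ p → p.height < s → ∀ r : ℕ,
    p.height ≤ ((r + i : ℕ) : ℕ∞) → GenBy A 𝔞 p r
  out : ∀ p : Ideal R, p.IsPrime → ¬ I ≤ p → p.height < i → ¬ A ≤ p

lemma height_lt_of_lt {q p : Ideal R} (hq : q.IsPrime) (hp : p.IsPrime) (hlt : q < p) {n : ℕ}
    (hn : p.height ≤ ((n + 1 : ℕ) : ℕ∞)) : q.height ≤ n := by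
  have := (height_add_one_le hq hp hlt).trans hn
  push_cast at this
  exact (ENat.add_le_add_iff_right ENat.one_ne_top).mp this

lemma GeneralPosition.step [IsNoetherianRing R] {I : Ideal R} {s i : ℕ}
    (h : GeneralPosition I 𝔞 s A i) (hrad : ∀ p : Ideal R, p.IsPrime → 𝔞 ≤ p → I ≤ p) {c : R}
    {L : Ideal R} (h𝔞 : 𝔞 = A ⊔ (Ideal.span {c} ⊔ L)) :
    ∃ b, b - c ∈ L ∧ GeneralPosition I 𝔞 s (A ⊔ Ideal.span {b}) (i + 1) := by
  classical
  have hfin : ∀ V : Ideal R, V.minimalPrimes.Finite := fun V =>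
    Ideal.finite_minimalPrimes_of_isNoetherianRing R V
  let X : Finset (Ideal R) := ((hfin A).toFinset ∪
    (Finset.range s).biUnion fun r => (hfin (I ⊔ genLocus A 𝔞 r)).toFinset).filter
      fun p => ¬ ∀ y ∈ 𝔞, InSat p (A ⊔ p * 𝔞) y
  have hX : ∀ p, p ∈ X ↔ (p ∈ A.minimalPrimes ∨ ∃ r < s, p ∈ (I ⊔ genLocus A 𝔞 r).minimalPrimes) ∧
      ¬ ∀ y ∈ 𝔞, InSat p (A ⊔ p * 𝔞) y := fun p => by simp [X]
  obtain ⟨b, hbc, hb⟩ := exists_avoid h𝔞 X.card X rfl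
    (fun p hp => by
      rcases ((hX p).mp hp).1 with h | ⟨r, -, h⟩
      · exact h.1.1
      · exact h.1.1)
    (fun p hp => ((hX p).mp hp).2)
  have hb𝔞 : b ∈ 𝔞 := by
    rw [h𝔞, ← sub_add_cancel b c]
    exact Ideal.mem_sup_right (add_mem (Ideal.mem_sup_right hbc)
      (Ideal.mem_sup_left (Ideal.mem_span_singleton_self c)))
  refine ⟨b, hbc, ⟨?_, ?_⟩⟩
  · intro p hp hIp hps r hpr
    by_cases h0 : ∀ y ∈ 𝔞, InSat p (A ⊔ p * 𝔞) y
    · exact (GenBy.of_inSat hp r (inSat_of_mul_sup hp h0)).mono le_sup_left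
    by_cases hr : GenBy A 𝔞 p r
    · exact hr.mono le_sup_left
    have hr1 : GenBy A 𝔞 p (r + 1) := h.gen p hp hIp hps (r + 1) (by
      rwa [show r + 1 + i = r + (i + 1) by ring])
    refine hr1.exchange hp hb𝔞 (hb p ((hX p).mpr ⟨Or.inr ⟨r, ?_, ⟨hp, ?_⟩, ?_⟩, h0⟩))
    · by_contra hrs
      refine hr (h.gen p hp hIp hps r (hps.le.trans ?_))
      exact_mod_cast (show s ≤ r + i by omega)
    · exact sup_le hIp (genLocus_le_iff.mpr hr)
    · rintro q ⟨hq, hIq⟩ hqp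
      rcases hqp.lt_or_eq with hlt | rfl
      · have hq1 := height_lt_of_lt (n := r + i) hq hp hlt (by exact_mod_cast hpr)
        exact absurd (h.gen q hq (le_sup_left.trans hIq)
          (lt_of_le_of_lt (Ideal.height_mono hqp) hps) r hq1)
          (genLocus_le_iff.mp (le_sup_right.trans hIq))
      · exact le_rfl
  · intro p hp hIp hpi hle
    have hAp : A ≤ p := le_sup_left.trans hle
    have hbp : b ∈ p := hle (Ideal.mem_sup_right (Ideal.mem_span_singleton_self b))
    obtain ⟨x, hx, hxp⟩ := SetLike.not_le_iff_exists.mp fun h𝔞p : 𝔞 ≤ p => hIp (hrad p hp h𝔞p)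
    have hpi' : p.height ≤ i := by
      push_cast at hpi
      exact Order.le_of_lt_add_one hpi
    refine hb p ((hX p).mpr ⟨Or.inl ⟨⟨hp, hAp⟩, ?_⟩, ?_⟩) ?_
    · rintro q ⟨hq, hAq⟩ hqp
      rcases hqp.lt_or_eq with hlt | rfl
      · refine absurd hAq (h.out q hq (fun hIq => hIp (hIq.trans hqp)) ?_)
        obtain ⟨e, he⟩ := exists_height_eq hq
        have := (height_add_one_le hq hp hlt).trans hpi'
        rw [he] at this ⊢
        norm_cast at *
      · exact le_rfl
    · intro hall
      obtain ⟨u, hu, hux⟩ := hall x hx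
      have hle' : A ⊔ p * 𝔞 ≤ p := sup_le hAp Ideal.mul_le_left
      exact not_mem_mul hp hu hxp (hle' hux)
    · refine InSat.of_mul hp hxp (InSat.of_mem hp (Ideal.mem_sup_right ?_))
      rw [mul_comm x b]
      exact Ideal.mul_mem_mul hbp hx

/-- Existence of a generating sequence of `𝔞` in general position. -/
lemma exists_generalPosition [IsNoetherianRing R] {I : Ideal R} {s : ℕ}
    (hrad : ∀ p : Ideal R, p.IsPrime → 𝔞 ≤ p → I ≤ p) (l : List R) :
    ∀ (i : ℕ) (A : Ideal R), i + l.length = s → GeneralPosition I 𝔞 s A i →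
      𝔞 = A ⊔ Ideal.ofList l → ∃ (a : ℕ → Ideal R) (b : ℕ → R), a i = A ∧ a s = 𝔞 ∧
        (∀ j, i ≤ j → j < s → a (j + 1) = a j ⊔ Ideal.span {b j}) ∧
        ∀ j, i ≤ j → j ≤ s → GeneralPosition I 𝔞 s (a j) j := by
  classical
  induction l with
  | nil =>
    intro i A hi hA h𝔞
    obtain rfl : i = s := by simpa using hi
    refine ⟨fun _ => A, fun _ => 0, rfl, by simpa using h𝔞.symm, fun j h1 h2 => by omega,
      fun j h1 h2 => ?_⟩
    rwa [le_antisymm h2 h1]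
  | cons c l ih =>
    intro i A hi hA h𝔞
    rw [Ideal.ofList_cons] at h𝔞
    rw [List.length_cons] at hi
    obtain ⟨b, hbc, hb⟩ := hA.step hrad h𝔞
    have hspan : Ideal.span {c} ⊔ Ideal.ofList l = Ideal.span {b} ⊔ Ideal.ofList l := by
      have key : ∀ x y : R, y - x ∈ Ideal.ofList l →
          Ideal.span {x} ⊔ Ideal.ofList l ≤ Ideal.span {y} ⊔ Ideal.ofList l := by
        intro x y hxy
        refine sup_le ?_ le_sup_right
        rw [Ideal.span_singleton_le_iff_mem, show x = y - (y - x) by ring]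
        exact Ideal.sub_mem _ (Ideal.mem_sup_left (Ideal.mem_span_singleton_self y))
          (Ideal.mem_sup_right hxy)
      refine le_antisymm (key c b hbc) (key b c ?_)
      rw [← neg_sub]
      exact neg_mem hbc
    obtain ⟨a', b', ha', has, hstep, hgp⟩ := ih (i + 1) (A ⊔ Ideal.span {b}) (by omega) hb
      (by rw [h𝔞, hspan, sup_assoc])
    refine ⟨Function.update a' i A, Function.update b' i b, Function.update_self .., ?_, ?_, ?_⟩
    · rw [Function.update_of_ne (by omega), has]
    · intro j hij hjs
      rw [Function.update_of_ne (by omega)]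
      by_cases hji : j = i
      · subst hji
        rw [Function.update_self, Function.update_self, ha']
      · rw [Function.update_of_ne hji, Function.update_of_ne hji]
        exact hstep j (by omega) hjs
    · intro j hij hjs
      by_cases hji : j = i
      · subst hji
        rwa [Function.update_self]
      · rw [Function.update_of_ne hji]
        exact hgp j (by omega) hjs

end Generators

/-! ### Elementwise form of the hypotheses -/

section Translation

variable {R : Type u} [CommRing R]

lemma dimAt_eq_height {p : Ideal R} (hp : p.IsPrime) : dimAt p hp = p.height := by
  have := hp
  exact IsLocalization.AtPrime.ringKrullDim_eq_height p (Localization.AtPrime p)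

lemma le_idealHeight_iff {K : Ideal R} {s : ℕ} : (s : WithBot ℕ∞) ≤ idealHeight K ↔
    ∀ p : Ideal R, p.IsPrime → K ≤ p → (s : ℕ∞) ≤ p.height := by
  rw [idealHeight, le_sInf_iff]
  constructor
  · intro h p hp hKp
    have := h _ ⟨p, hp, hKp, rfl⟩
    rw [dimAt_eq_height] at this
    exact_mod_cast this
  · rintro h _ ⟨p, hp, hKp, rfl⟩
    rw [dimAt_eq_height]
    exact_mod_cast h p hp hKp

lemma le_height_of_idealGrade [IsNoetherianRing R] {I : Ideal R} {g : ℕ}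
    (hg : idealGrade I = (g : ℕ∞)) (p : Ideal R) (hp : p.IsPrime) (hIp : I ≤ p) :
    (g : ℕ∞) ≤ p.height := by
  rw [← hg]
  refine sSup_le ?_
  rintro _ ⟨l, hl, hreg, rfl⟩
  exact (regIdeal_of_isWeaklyRegular hreg.toIsWeaklyRegular).le_height p hp
    (Ideal.span_le.mpr fun x hx => hIp (hl x hx))

/-- Elements of an ideal whose extension to `R_p` has few generators are generated locally at
`p` by few elements. -/
lemma exists_generators_of_mu_le {I p : Ideal R} (hp : p.IsPrime) {r : ℕ}
    (h : haveI := hp; mu (Localization.AtPrime p)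
        (I.map (algebraMap R (Localization.AtPrime p))) ≤ r) :
    ∃ F : Finset R, F.card ≤ r ∧ (∀ x ∈ F, x ∈ I) ∧
      ∀ y ∈ I, ∃ u, u ∉ p ∧ u * y ∈ Ideal.span (F : Set R) := by
  classical
  have := hp
  let S := Localization.AtPrime p
  let J := I.map (algebraMap R S)
  let T : Set ℕ∞ := {n : ℕ∞ | ∃ s : Finset J, (s.card : ℕ∞) = n ∧
    Submodule.span S (s : Set J) = ⊤}
  have hT : sInf T ≤ r := h
  have hne : T.Nonempty := by
    by_contra hcon
    rw [Set.not_nonempty_iff_eq_empty] at hcon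
    rw [hcon, sInf_empty] at hT
    exact ENat.natCast_ne_top r (top_le_iff.mp hT)
  obtain ⟨G, hG, hspan⟩ := csInf_mem hne
  have hGr : G.card ≤ r := by
    rw [← hG] at hT
    exact_mod_cast hT
  have hmem : ∀ z : J, ∃ x : R, x ∈ I ∧ ∃ v : R, v ∉ p ∧
      z.1 * algebraMap R S v = algebraMap R S x := by
    intro z
    obtain ⟨⟨x, v⟩, hxv⟩ := (IsLocalization.mem_map_algebraMap_iff p.primeCompl S).mp z.2
    exact ⟨x.1, x.2, v.1, v.2, hxv⟩
  choose num hnum den hden hnd using hmem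
  refine ⟨G.image num, Finset.card_image_le.trans hGr, ?_, fun y hy => ?_⟩
  · intro x hx
    obtain ⟨z, -, rfl⟩ := Finset.mem_image.mp hx
    exact hnum z
  · let F : Set R := ((G.image num : Finset R) : Set R)
    have key : ∀ z : J, z ∈ Submodule.span S (G : Set J) →
        z.1 ∈ (Ideal.span F).map (algebraMap R S) := by
      intro z hz
      induction hz using Submodule.span_induction with
      | mem z hz =>
        have h1 : z.1 * algebraMap R S (den z) ∈ (Ideal.span F).map (algebraMap R S) := by
          rw [hnd z]
          exact Ideal.mem_map_of_mem _ (Ideal.subset_span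
            (Finset.mem_coe.mpr (Finset.mem_image_of_mem _ hz)))
        have hu : IsUnit (algebraMap R S (den z)) :=
          IsLocalization.map_units S (⟨den z, hden z⟩ : p.primeCompl)
        exact (Ideal.mul_unit_mem_iff_mem _ hu).mp h1
      | zero => exact Ideal.zero_mem _
      | add x y _ _ hx hy => exact Ideal.add_mem _ hx hy
      | smul a x _ hx => exact Ideal.mul_mem_left _ a hx
    have hy' := key ⟨algebraMap R S y, Ideal.mem_map_of_mem _ hy⟩ (hspan ▸ Submodule.mem_top)
    obtain ⟨⟨x, v⟩, hxv⟩ := (IsLocalization.mem_map_algebraMap_iff p.primeCompl S).mp hy'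
    rw [← map_mul] at hxv
    obtain ⟨c, hc⟩ := (IsLocalization.eq_iff_exists p.primeCompl S).mp hxv
    refine ⟨c.1 * v.1, not_mem_mul hp c.2 v.2, ?_⟩
    have : (c.1 * v.1) * y = c.1 * x.1 := by rw [← hc]; ring
    rw [this]
    exact Ideal.mul_mem_left _ _ x.2

lemma GeneralPosition.bot [IsNoetherianRing R] {I 𝔞 : Ideal R} {s : ℕ} (hGs : IdealGs I s)
    (h𝔞I : 𝔞 ≤ I)
    (hK : ∀ p : Ideal R, p.IsPrime → Submodule.colon 𝔞 I ≤ p → (s : ℕ∞) ≤ p.height) :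
    GeneralPosition I 𝔞 s ⊥ 0 := by
  classical
  refine ⟨fun p hp hIp hps r hr => ?_, fun p hp _ h => by simp at h⟩
  rw [add_zero] at hr
  obtain ⟨F, hF, hFI, hgen⟩ := exists_generators_of_mu_le (r := r) hp (I := I) (by
    have h1 := hGs p hp hIp (by rw [dimAt_eq_height]; exact_mod_cast hps)
    rw [dimAt_eq_height] at h1
    exact (WithBot.coe_le_coe.mp h1).trans hr)
  obtain ⟨u, hu, hup⟩ := SetLike.not_le_iff_exists.mp
    (show ¬ Submodule.colon 𝔞 I ≤ p from fun h => (hK p hp h).not_gt hps)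
  have hu' : ∀ x ∈ I, u * x ∈ 𝔞 := fun x hx => Submodule.mem_colon.mp hu x hx
  obtain ⟨v, hv, hvy⟩ := exists_uniform hp
    (fun y hy => (hgen y (h𝔞I hy) : InSat p (Ideal.span (F : Set R)) y))
  refine ⟨F.image (u * ·), Finset.card_image_le.trans hF, ?_, u * v, not_mem_mul hp hup hv,
    fun y hy => ?_⟩
  · intro x hx
    obtain ⟨z, hz, rfl⟩ := Finset.mem_image.mp hx
    exact hu' z (hFI z hz)
  · rw [bot_sup_eq, mul_assoc]
    have : ∀ w ∈ Ideal.span (F : Set R),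
        u * w ∈ Ideal.span ((F.image (u * ·) : Finset R) : Set R) := by
      intro w hw
      induction hw using Submodule.span_induction with
      | mem x hx =>
        exact Ideal.subset_span (Finset.mem_coe.mpr (Finset.mem_image_of_mem (u * ·) hx))
      | zero => rw [mul_zero]; exact Ideal.zero_mem _
      | add x y _ _ hx hy => rw [mul_add]; exact Ideal.add_mem _ hx hy
      | smul a x _ hx => rw [smul_eq_mul, mul_left_comm]; exact Ideal.mul_mem_left _ _ hx
    exact this _ (hvy y hy)

lemma inSat_of_height_le {I 𝔞 A p : Ideal R} {s i : ℕ} (h : GeneralPosition I 𝔞 s A i)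
    (hK : ∀ p : Ideal R, p.IsPrime → Submodule.colon 𝔞 I ≤ p → (s : ℕ∞) ≤ p.height)
    (hp : p.IsPrime) (hIp : I ≤ p) (hpi : p.height ≤ i) (his : i < s) :
    ∃ u, u ∉ p ∧ ∀ y ∈ I, u * y ∈ A := by
  classical
  have hps : p.height < s := lt_of_le_of_lt hpi (by exact_mod_cast his)
  obtain ⟨F, hF, -, u, hu, huy⟩ := h.gen p hp hIp hps 0 (by simpa using hpi)
  obtain rfl : F = ∅ := Finset.card_eq_zero.mp (by omega)
  obtain ⟨v, hv, hvp⟩ := SetLike.not_le_iff_exists.mp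
    (show ¬ Submodule.colon 𝔞 I ≤ p from fun h => (hK p hp h).not_gt hps)
  refine ⟨u * v, not_mem_mul hp hu hvp, fun y hy => ?_⟩
  rw [mul_assoc]
  simpa using huy _ (Submodule.mem_colon.mp hv y hy)

/-- Serre's condition `S_2`, elementwise: a prime `q ⊇ K` with a saturated chain of length two
above `K` contains a regular sequence of length two locally at `q`. -/
lemma exists_regular_of_serreS2 {K : Ideal R} (hS : SerreS2 (R ⧸ K)) {q₀ q₁ q : Ideal R}
    (hq₀ : q₀.IsPrime) (hq₁ : q₁.IsPrime) (hq : q.IsPrime) (hK : K ≤ q₀) (h₁ : q₀ < q₁)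
    (h₂ : q₁ < q) : ∃ x ∈ q, ∃ x' ∈ q, (∀ w, InSat q K (x * w) → InSat q K w) ∧
      ∀ w, InSat q (K ⊔ Ideal.span {x}) (x' * w) → InSat q (K ⊔ Ideal.span {x}) w := by
  let π := Ideal.Quotient.mk K
  have hsurj : Function.Surjective π := Ideal.Quotient.mk_surjective
  have hker : ∀ P : Ideal R, K ≤ P → (P.map π).comap π = P := fun P hP => by
    rw [Ideal.comap_map_of_surjective π hsurj]
    refine sup_eq_left.mpr ?_
    rw [← RingHom.ker_eq_comap_bot, Ideal.mk_ker]
    exact hP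
  have hprime : ∀ P : Ideal R, P.IsPrime → K ≤ P → (P.map π).IsPrime := fun P hP hKP => by
    have := hP
    exact Ideal.map_isPrime_of_surjective hsurj (by rwa [Ideal.mk_ker])
  have hlt : ∀ P Q : Ideal R, K ≤ P → P < Q → P.map π < Q.map π := fun P Q hP hPQ => by
    refine lt_of_le_of_ne (Ideal.map_mono hPQ.le) fun heq => ?_
    have := congrArg (Ideal.comap π) heq
    rw [hker P hP, hker Q (hP.trans hPQ.le)] at this
    exact hPQ.ne this
  have hKq₁ : K ≤ q₁ := hK.trans h₁.le
  have hKq : K ≤ q := hKq₁.trans h₂.le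
  have hQ := hprime q hq hKq
  have hht : (2 : ℕ∞) ≤ (q.map π).height := by
    have e₁ := height_add_one_le (hprime q₀ hq₀ hK) (hprime q₁ hq₁ hKq₁) (hlt _ _ hK h₁)
    have e₂ := height_add_one_le (hprime q₁ hq₁ hKq₁) hQ (hlt _ _ hKq₁ h₂)
    calc (2 : ℕ∞) = 0 + 1 + 1 := by norm_num
      _ ≤ (q₀.map π).height + 1 + 1 := by gcongr; exact zero_le
      _ ≤ (q.map π).height := (add_le_add_left e₁ 1).trans e₂
  let S := Localization.AtPrime (q.map π)
  have hht' : (2 : WithBot ℕ∞) ≤ (q.map π).height := WithBot.coe_le_coe.mpr hht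
  have hdepth := hS (q.map π) hQ
  rw [IsLocalization.AtPrime.ringKrullDim_eq_height (q.map π) (Localization.AtPrime (q.map π)),
    min_eq_left hht'] at hdepth
  have hdepth' : (2 : ℕ∞) ≤ idealGrade (maximalIdeal S) := WithBot.coe_le_coe.mp hdepth
  obtain ⟨l, hlm, hreg, hlen⟩ : ∃ l : List S, (∀ x ∈ l, x ∈ maximalIdeal S) ∧
      RingTheory.Sequence.IsRegular S l ∧ 2 ≤ l.length := by
    by_contra hcon
    push Not at hcon
    have : idealGrade (maximalIdeal S) ≤ 1 := by
      refine sSup_le ?_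
      rintro _ ⟨l, hl, hr, rfl⟩
      exact_mod_cast Nat.le_of_lt_succ (hcon l hl hr)
    have h21 := hdepth'.trans this
    norm_num at h21
  let φ : R →+* S := (algebraMap (R ⧸ K) S).comp π
  have hφunit : ∀ u, u ∉ q → IsUnit (φ u) := fun u hu =>
    IsLocalization.map_units S (⟨π u, fun h => hu (by
      rw [← hker q hKq]; exact h)⟩ : (q.map π).primeCompl)
  have hφker : ∀ y, φ y = 0 ↔ InSat q K y := by
    intro y
    change algebraMap (R ⧸ K) S (π y) = 0 ↔ _
    rw [IsLocalization.map_eq_zero_iff (q.map π).primeCompl S]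
    constructor
    · rintro ⟨⟨c, hc⟩, hcy⟩
      obtain ⟨u, rfl⟩ := hsurj c
      refine ⟨u, fun hu => hc (Ideal.mem_map_of_mem π hu), ?_⟩
      rw [← Ideal.Quotient.eq_zero_iff_mem, map_mul]
      exact hcy
    · rintro ⟨u, hu, huy⟩
      refine ⟨⟨π u, fun h => hu (by rw [← hker q hKq]; exact h)⟩, ?_⟩
      change π u * π y = 0
      rw [← map_mul]
      exact Ideal.Quotient.eq_zero_iff_mem.mpr huy
  have hφsurj : ∀ z : S, ∃ x u, u ∉ q ∧ z * φ u = φ x := by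
    intro z
    obtain ⟨⟨a, c⟩, hac⟩ := IsLocalization.surj (q.map π).primeCompl z
    obtain ⟨x, rfl⟩ := hsurj a
    obtain ⟨u, hu⟩ := hsurj c.1
    refine ⟨x, u, fun h => c.2 (hu ▸ Ideal.mem_map_of_mem π h), ?_⟩
    change z * algebraMap _ S (π u) = _
    rw [hu]
    exact hac
  have hφq : ∀ x, φ x ∈ maximalIdeal S → x ∈ q := fun x hx => by
    by_contra hxq
    exact (mem_maximalIdeal _).mp hx (hφunit x hxq)
  have hw := hreg.toIsWeaklyRegular
  have r₁ : ∀ y, y * l[0] = 0 → y = 0 := fun y hy => by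
    have := regular_of_isWeaklyRegular hw 0 (by omega) y (by simpa using hy)
    simpa using this
  have htake : Ideal.ofList (l.take 1) = Ideal.span {l[0]} := by
    rw [List.take_one, List.head?_eq_getElem?, List.getElem?_eq_getElem (by omega)]
    simp
  have r₂ : ∀ y, y * l[1] ∈ Ideal.span {l[0]} → y ∈ Ideal.span {l[0]} := fun y hy => by
    have := regular_of_isWeaklyRegular hw 1 (by omega) y (by rwa [htake])
    rwa [htake] at this
  obtain ⟨x, u, hu, hx⟩ := hφsurj l[0]
  obtain ⟨x', u', hu', hx'⟩ := hφsurj l[1]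
  have hspan : ∀ y, φ y ∈ Ideal.span {l[0]} ↔ InSat q (K ⊔ Ideal.span {x}) y := by
    intro y
    rw [Ideal.mem_span_singleton']
    constructor
    · rintro ⟨a, ha⟩
      obtain ⟨r, v, hv, har⟩ := hφsurj a
      have h0 : φ (u * v * y - r * x) = 0 := by
        rw [map_sub, map_mul, map_mul, map_mul, ← ha, ← hx, ← har]
        ring
      refine InSat.of_mul hq (not_mem_mul hq hu hv) ?_
      rw [← sub_add_cancel (u * v * y) (r * x)]
      exact (((hφker _).mp h0).mono le_sup_left).add hq (InSat.of_mem hq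
        (Ideal.mem_sup_right (Ideal.mul_mem_left _ _ (Ideal.mem_span_singleton_self x))))
    · rintro ⟨v, hv, hvy⟩
      obtain ⟨k, hk, w, hw, hkw⟩ := Submodule.mem_sup.mp hvy
      obtain ⟨r, rfl⟩ := Ideal.mem_span_singleton'.mp hw
      have hk0 : φ k = 0 := (hφker k).mpr (InSat.of_mem hq hk)
      have hvy' : φ v * φ y = φ r * (l[0] * φ u) := by
        rw [hx, ← map_mul, ← map_mul, ← hkw, map_add, hk0, zero_add]
      obtain ⟨c, hc⟩ := (hφunit v hv).exists_left_inv
      refine ⟨c * φ r * φ u, ?_⟩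
      calc c * φ r * φ u * l[0] = c * (φ r * (l[0] * φ u)) := by ring
        _ = φ y := by rw [← hvy', ← mul_assoc, hc, one_mul]
  refine ⟨x, hφq x ?_, x', hφq x' ?_, fun w hw => ?_, fun w hw => ?_⟩
  · rw [← hx]
    exact Ideal.mul_mem_right _ _ (hlm _ (List.getElem_mem _))
  · rw [← hx']
    exact Ideal.mul_mem_right _ _ (hlm _ (List.getElem_mem _))
  · rw [← hφker] at hw ⊢
    rw [map_mul, ← hx] at hw
    have h1 := r₁ (φ u * φ w) (by rw [← hw]; ring)
    exact ((hφunit u hu).mul_right_eq_zero).mp h1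
  · rw [← hspan] at hw ⊢
    rw [map_mul, ← hx'] at hw
    have h1 := r₂ (φ u' * φ w) (by
      rwa [show φ u' * φ w * l[1] = l[1] * φ u' * φ w by ring])
    exact (Ideal.unit_mul_mem_iff_mem _ (hφunit u' hu')).mp h1

end Translation

/-! ### Residual intersections by general elements -/

section Residual

variable {R : Type u} [CommRing R]

lemma inSat_of_forall_assp [IsNoetherianRing R] {V p : Ideal R} (hp : p.IsPrime) {y : R}
    (h : ∀ q, Assp V q → q ≤ p → InSat q V y) : InSat p V y := by
  by_contra hy
  obtain ⟨q, hq, hqp, hw⟩ := exists_assp_le hp hy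
  obtain ⟨u, hu, huy⟩ := h q hq hqp
  exact hu (hw u huy)

lemma mem_of_forall_assp [IsNoetherianRing R] [IsLocalRing R] {V : Ideal R} {y : R}
    (h : ∀ q, Assp V q → InSat q V y) : y ∈ V :=
  inSat_maximalIdeal.mp (inSat_of_forall_assp (maximalIdeal.isMaximal R).isPrime
    fun q hq _ => h q hq)

lemma inSat_of_mul_mem_of_not_assp [IsNoetherianRing R] {V q : Ideal R} (hq : q.IsPrime)
    (hV : ¬ Assp V q) {y : R} (h : ∀ z ∈ q, InSat q V (z * y)) : InSat q V y := by
  by_contra hy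
  obtain ⟨q', hq', hle, r, hr⟩ := exists_assp_of_not_inSat hq hy
  have hqq' : q ≤ q' := fun z hz => by
    obtain ⟨u, hu, huz⟩ := h z hz
    have h1 : (u * z) * (r * y) ∈ V := by
      rw [show (u * z) * (r * y) = r * (u * (z * y)) by ring]
      exact V.mul_mem_left _ huz
    exact (hq'.mem_or_mem ((hr _).mp h1)).resolve_left fun h => hu (hle h)
  obtain rfl := le_antisymm hle hqq'
  exact hV ⟨hq, _, hr⟩

lemma Assp.of_colon [IsNoetherianRing R] {I V q : Ideal R} (h : Assp (Submodule.colon V I) q) :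
    Assp V q := by
  classical
  obtain ⟨hq, y, hy⟩ := h
  obtain ⟨F, hF⟩ := (isNoetherianRing_iff_ideal_fg R).mp inferInstance I
  by_contra hcon
  have hall : ∀ x ∈ F, ∃ w, w ∉ q ∧ w * (x * y) ∈ V := by
    intro x hx
    have hxI : x ∈ I := hF ▸ Ideal.subset_span hx
    refine inSat_of_mul_mem_of_not_assp hq hcon fun z hz => ⟨1, one_not_mem hq, ?_⟩
    have := Submodule.mem_colon.mp ((hy z).mpr hz) x hxI
    rw [smul_eq_mul] at this
    rwa [one_mul, show z * (x * y) = z * y * x by ring]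
  choose! w hw hwV using hall
  have hprod : ∏ x ∈ F, w x ∉ q := fun h => by
    obtain ⟨x, hx, hxq⟩ := hq.prod_mem_iff.mp h
    exact hw x hx hxq
  refine hprod ((hy _).mp (Submodule.mem_colon.mpr fun x hx => ?_))
  have hxF : x ∈ Ideal.span (F : Set R) := by rw [← hF] at hx; exact hx
  clear hx
  induction hxF using Submodule.span_induction with
  | mem x hxF =>
    rw [← Finset.mul_prod_erase F w hxF, smul_eq_mul,
      show (w x * ∏ x ∈ F.erase x, w x) * y * x =
        (∏ x ∈ F.erase x, w x) * (w x * (x * y)) by ring]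
    exact V.mul_mem_left _ (hwV x hxF)
  | zero => simp
  | add x z _ _ hx hz =>
    rw [smul_add]
    exact V.add_mem hx hz
  | smul r x _ hx =>
    rw [smul_comm]
    exact V.mul_mem_left _ hx

/-- A sequence `b` with partial ideals `a i = (b 0, …, b (i - 1)) ⊆ I` whose residuals
`a i : I` are geometric residual intersections, over a ring with Gorenstein Ext behaviour,
together with the local vanishing of Ext of the powers of `I`. -/
structure Residual [IsLocalRing R] [IsNoetherianRing R] (I : Ideal R) (g s : ℕ) (a : ℕ → Ideal R)
    (b : ℕ → R) : Prop where
  hE : ExtGorenstein R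
  hgs : g + 1 ≤ s
  grade : ∀ p : Ideal R, p.IsPrime → I ≤ p → (g : ℕ∞) ≤ p.height
  zero : a 0 = ⊥
  step : ∀ i < s, a (i + 1) = a i ⊔ Ideal.span {b i}
  le : a s ≤ I
  gen : ∀ i < s, ∀ p : Ideal R, p.IsPrime → I ≤ p → p.height ≤ i →
    ∃ u, u ∉ p ∧ ∀ y ∈ I, u * y ∈ a i
  out : ∀ i ≤ s, ∀ p : Ideal R, p.IsPrime → ¬ I ≤ p → p.height < i → ¬ a i ≤ p
  serre : ∀ i, g ≤ i → i < s → SerreS2 (R ⧸ Submodule.colon (a i) I)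
  ext : ∀ p : Ideal R, p.IsPrime → I ≤ p → p.height ≤ s → ∀ j, 1 ≤ j → j ≤ s - g →
    EV (R ⧸ I ^ j) (g + j) p

namespace Residual

variable [IsLocalRing R] [IsNoetherianRing R] {I : Ideal R} {g s : ℕ} {a : ℕ → Ideal R}
  {b : ℕ → R} (H : Residual I g s a b)

include H

lemma mono {i j : ℕ} (hij : i ≤ j) (hj : j ≤ s) : a i ≤ a j := by
  induction j, hij using Nat.le_induction with
  | base => exact le_rfl
  | succ j hij ih =>
    rw [H.step j (by omega)]
    exact (ih (by omega)).trans le_sup_left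

lemma a_le {i : ℕ} (hi : i ≤ s) : a i ≤ I := (H.mono hi le_rfl).trans H.le

lemma b_mem_succ {i : ℕ} (hi : i < s) : b i ∈ a (i + 1) := by
  rw [H.step i hi]
  exact Ideal.mem_sup_right (Ideal.mem_span_singleton_self _)

lemma b_mem {i : ℕ} (hi : i < s) : b i ∈ I := H.a_le hi (H.b_mem_succ hi)

lemma b_not_mem {i : ℕ} (hi : i < s) {q : Ideal R} (hq : q.IsPrime) (hIq : ¬ I ≤ q)
    (hqi : q.height ≤ i) (hle : a i ≤ q) : b i ∉ q := by
  intro hb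
  refine H.out (i + 1) hi q hq hIq (lt_of_le_of_lt hqi (by exact_mod_cast i.lt_succ_self)) ?_
  rw [H.step i hi]
  exact sup_le hle ((Ideal.span_singleton_le_iff_mem q).mpr hb)

lemma b_regular {i : ℕ} (hi : i < g) (hreg : RegIdeal (a i) i) (y : R) (hy : y * b i ∈ a i) :
    y ∈ a i := by
  have := H.hgs
  refine regular_of_not_mem_assp (fun q hq => ?_) y hy
  have hqi := H.hE.height_le_of_assp hreg hq
  refine H.b_not_mem (by omega) hq.1 (fun hIq => ?_) hqi hq.le
  have h1 := (H.grade q hq.1 hIq).trans hqi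
  exact absurd (by exact_mod_cast h1 : g ≤ i) (by omega)

lemma regIdeal {i : ℕ} (hi : i ≤ g) : RegIdeal (a i) i := by
  have := H.hgs
  induction i with
  | zero => rw [H.zero]; exact .zero
  | succ i ih =>
    have hreg := ih (by omega)
    rw [H.step i (by omega)]
    exact hreg.succ (H.b_regular (by omega) hreg)

/-- The multiplier of `b i` into `a i` multiplies `I` into `a i`. -/
lemma mem_colon_of_mul_mem {i : ℕ} (hi : i < s)
    (hA : ∀ q, Assp (a i) q → q.height ≤ i) {x : R} (hx : x * b i ∈ a i) :
    x ∈ Submodule.colon (a i) I := by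
  refine Submodule.mem_colon.mpr fun y hy => mem_of_forall_assp fun q hq => ?_
  by_cases hIq : I ≤ q
  · obtain ⟨u, hu, huy⟩ := H.gen i hi q hq.1 hIq (hA q hq)
    refine ⟨u, hu, ?_⟩
    rw [smul_eq_mul, mul_left_comm]
    exact Ideal.mul_mem_left _ _ (huy y hy)
  · refine ⟨b i, H.b_not_mem hi hq.1 hIq (hA q hq) hq.le, ?_⟩
    rw [smul_eq_mul, show b i * (x * y) = y * (x * b i) by ring]
    exact Ideal.mul_mem_left _ _ hx

lemma mem_of_mem_colon {i : ℕ} (hi : i < s) (hA : ∀ q, Assp (a i) q → q.height ≤ i) {x : R}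
    (hx : x ∈ Submodule.colon (a i) I) (hxI : x ∈ I) : x ∈ a i := by
  refine mem_of_forall_assp fun q hq => ?_
  by_cases hIq : I ≤ q
  · obtain ⟨u, hu, huy⟩ := H.gen i hi q hq.1 hIq (hA q hq)
    exact ⟨u, hu, huy x hxI⟩
  · obtain ⟨u, hu, huq⟩ := SetLike.not_le_iff_exists.mp hIq
    refine ⟨u, huq, ?_⟩
    rw [mul_comm]
    exact Submodule.mem_colon.mp hx u hu

/-- The associated primes of `a i` have height at most `i`. -/
lemma height_le {i : ℕ} (hi : i ≤ s) : ∀ q, Assp (a i) q → q.height ≤ i := by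
  induction i with
  | zero => exact fun q hq => H.hE.height_le_of_assp (H.regIdeal (Nat.zero_le g)) hq
  | succ i ih =>
    by_cases hig : i + 1 ≤ g
    · exact fun q hq => H.hE.height_le_of_assp (H.regIdeal hig) hq
    have hA := ih (by omega)
    rintro q ⟨hq, y, hy⟩
    by_contra hht
    have hht2 : ((i + 2 : ℕ) : ℕ∞) ≤ q.height := by
      obtain ⟨e, he⟩ := exists_height_eq hq
      rw [he] at hht ⊢
      norm_cast at *
      omega
    have hnot : ¬ Assp (a i) q := fun h => by
      have h1 : ((i + 2 : ℕ) : ℕ∞) ≤ (i : ℕ) := hht2.trans (hA q h)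
      norm_cast at h1
      omega
    have hdec : ∀ z ∈ q, ∃ r, z * y - r * b i ∈ a i := fun z hz => by
      have h1 := (hy z).mpr hz
      rw [H.step i (by omega)] at h1
      obtain ⟨α, hα, w, hw, hαw⟩ := Submodule.mem_sup.mp h1
      obtain ⟨r, rfl⟩ := Ideal.mem_span_singleton'.mp hw
      exact ⟨r, by rwa [← hαw, add_sub_cancel_right]⟩
    have hfinal : ¬ InSat q (a (i + 1)) y := by
      rintro ⟨u, hu, huy⟩
      exact hu ((hy u).mp huy)
    choose! ρ hρ using hdec
    let K := Submodule.colon (a i) I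
    have hbI : b i ∈ I := H.b_mem (by omega)
    have hKb : ∀ k ∈ K, k * b i ∈ a i := fun k hk => Submodule.mem_colon.mp hk _ hbI
    have hai : a i ≤ a (i + 1) := H.mono (by omega) (by omega)
    by_cases hKq : K ≤ q
    · obtain ⟨q₀, hq₀, hle⟩ := exists_minimal_le hq hKq
      have hq₀i : q₀.height ≤ i := hA q₀ (assp_of_minimal hq₀).of_colon
      obtain ⟨e, he⟩ := exists_height_eq hq₀.1.1
      obtain ⟨q₁, hq₁, hlt₁, hlt₂⟩ := H.hE.exists_between hq₀.1.1 hq hle he (by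
        refine le_trans ?_ hht2
        rw [he] at hq₀i
        norm_cast at *
        omega)
      obtain ⟨x, hx, x', hx', hreg, hreg'⟩ := exists_regular_of_serreS2
        (H.serre i (by omega) (by omega)) hq₀.1.1 hq₁ hq hq₀.1.2 hlt₁ hlt₂
      have hcomm : ∀ z ∈ q, ∀ z' ∈ q, z' * ρ z - z * ρ z' ∈ K := fun z hz z' hz' => by
        refine H.mem_colon_of_mul_mem (by omega) hA ?_
        rw [show (z' * ρ z - z * ρ z') * b i = z * (z' * y - ρ z' * b i) -
          z' * (z * y - ρ z * b i) by ring]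
        exact Ideal.sub_mem _ (Ideal.mul_mem_left _ _ (hρ z' hz'))
          (Ideal.mul_mem_left _ _ (hρ z hz))
      obtain ⟨u, hu, huρ⟩ := hreg' (ρ x) ⟨1, one_not_mem hq, by
        rw [one_mul, ← sub_add_cancel (x' * ρ x) (x * ρ x')]
        exact add_mem (Ideal.mem_sup_left (hcomm x hx x' hx'))
          (Ideal.mem_sup_right (Ideal.mul_mem_right _ _ (Ideal.mem_span_singleton_self x)))⟩
      obtain ⟨k, hk, w, hw, hkw⟩ := Submodule.mem_sup.mp huρ
      obtain ⟨r, rfl⟩ := Ideal.mem_span_singleton'.mp hw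
      have hloc : ∀ z ∈ q, InSat q (a i) (z * (u * y - r * b i)) := fun z hz => by
        have h1 : x * (z * r - u * ρ z) ∈ K := by
          rw [show x * (z * r - u * ρ z) = u * (z * ρ x - x * ρ z) - z * k by
            have : u * ρ x = k + r * x := hkw.symm
            linear_combination -z * this]
          exact K.sub_mem (K.mul_mem_left _ (hcomm x hx z hz)) (K.mul_mem_left _ hk)
        obtain ⟨v, hv, hvK⟩ := hreg _ (InSat.of_mem hq h1)
        refine ⟨v, hv, ?_⟩
        rw [show v * (z * (u * y - r * b i)) =
          (v * u) * (z * y - ρ z * b i) - v * (z * r - u * ρ z) * b i by ring]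
        exact Ideal.sub_mem _ (Ideal.mul_mem_left _ _ (hρ z hz)) (hKb _ hvK)
      have h2 := (inSat_of_mul_mem_of_not_assp hq hnot hloc).mono hai
      refine hfinal (InSat.of_mul hq hu ?_)
      rw [← sub_add_cancel (u * y) (r * b i)]
      exact h2.add hq (InSat.of_mem hq (Ideal.mul_mem_left _ _ (H.b_mem_succ (by omega))))
    · obtain ⟨u, hu, huq⟩ := SetLike.not_le_iff_exists.mp hKq
      refine hfinal ((inSat_of_mul_mem_of_not_assp hq hnot fun z hz => ⟨u, huq, ?_⟩).mono hai)
      rw [show u * (z * y) = u * (z * y - ρ z * b i) + ρ z * (u * b i) by ring]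
      exact Ideal.add_mem _ (Ideal.mul_mem_left _ _ (hρ z hz))
        (Ideal.mul_mem_left _ _ (hKb u hu))

lemma mem_colon_iff {i : ℕ} (hi : i < s) {x : R} :
    x ∈ Submodule.colon (a i) I ↔ x * b i ∈ a i :=
  ⟨fun h => Submodule.mem_colon.mp h _ (H.b_mem hi),
    fun h => H.mem_colon_of_mul_mem hi (H.height_le hi.le) h⟩

/-- Local form of `((a i : I) + b i) ∩ I = a (i + 1)`. -/
lemma inSat_succ {i : ℕ} (hi : i < s) {p : Ideal R} {x r : R} (hx : x ∈ I)
    (h : InSat p (Submodule.colon (a i) I) (x - r * b i)) : InSat p (a (i + 1)) x := by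
  obtain ⟨u, hu, huK⟩ := h
  have hbI := H.b_mem hi
  have h1 := H.mem_of_mem_colon hi (H.height_le hi.le) huK
    (I.mul_mem_left _ (I.sub_mem hx (I.mul_mem_left _ hbI)))
  refine ⟨u, hu, ?_⟩
  rw [show u * x = u * (x - r * b i) + u * r * b i by ring]
  exact Ideal.add_mem _ (H.mono (by omega) hi h1) (Ideal.mul_mem_left _ _ (H.b_mem_succ hi))

end Residual

end Residual

/-! ### Subquotients of the ring -/

section Subquotient

variable {R : Type u} [CommRing R]

/-- The subquotient `U / (U ∩ V)` of the ring. -/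
def SubQ (U V : Ideal R) : Type u := ↥U ⧸ Submodule.comap U.subtype V

variable (U V : Ideal R)

instance : AddCommGroup (SubQ U V) :=
  inferInstanceAs (AddCommGroup (↥U ⧸ Submodule.comap U.subtype V))

instance : Module R (SubQ U V) :=
  inferInstanceAs (Module R (↥U ⧸ Submodule.comap U.subtype V))

instance [IsNoetherianRing R] : Module.Finite R (SubQ U V) :=
  inferInstanceAs (Module.Finite R (↥U ⧸ Submodule.comap U.subtype V))

variable {U V}

/-- The class of an element of `U` in `U / (U ∩ V)`. -/
def SubQ.mk (x : R) (hx : x ∈ U) : SubQ U V :=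
  (Submodule.comap U.subtype V).mkQ ⟨x, hx⟩

lemma SubQ.exists_rep (m : SubQ U V) : ∃ x, ∃ hx : x ∈ U, SubQ.mk x hx = m := by
  obtain ⟨⟨x, hx⟩, h⟩ := (Submodule.comap U.subtype V).mkQ_surjective m
  exact ⟨x, hx, h⟩

lemma SubQ.mk_eq_zero {x : R} {hx : x ∈ U} : (SubQ.mk x hx : SubQ U V) = 0 ↔ x ∈ V :=
  (Submodule.Quotient.mk_eq_zero (Submodule.comap U.subtype V) :
    (Submodule.comap U.subtype V).mkQ ⟨x, hx⟩ = 0 ↔ _)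

lemma SubQ.smul_mk (r : R) {x : R} (hx : x ∈ U) :
    r • (SubQ.mk x hx : SubQ U V) = SubQ.mk (r * x) (U.mul_mem_left r hx) := rfl

lemma SubQ.mk_eq_mk {x y : R} {hx : x ∈ U} {hy : y ∈ U} :
    (SubQ.mk x hx : SubQ U V) = SubQ.mk y hy ↔ x - y ∈ V :=
  Submodule.Quotient.eq (Submodule.comap U.subtype V) (x := ⟨x, hx⟩) (y := ⟨y, hy⟩)

variable {U' V' : Ideal R}

/-- Multiplication by an element as a map of subquotients. -/
def SubQ.mul (b : R) (hU : ∀ x ∈ U, b * x ∈ U') (hV : ∀ x ∈ V, b * x ∈ V') :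
    SubQ U V →ₗ[R] SubQ U' V' :=
  Submodule.mapQ (Submodule.comap U.subtype V) (Submodule.comap U'.subtype V')
    ((LinearMap.lsmul R R b).restrict hU) fun x hx => hV x.1 hx

lemma SubQ.mul_mk {b : R} (hU : ∀ x ∈ U, b * x ∈ U') (hV : ∀ x ∈ V, b * x ∈ V') {x : R}
    (hx : x ∈ U) : SubQ.mul b hU hV (SubQ.mk x hx) = SubQ.mk (b * x) (hU x hx) := rfl

lemma SubQ.mul_one_surjective (hU : ∀ x ∈ U, 1 * x ∈ U) (hV : ∀ x ∈ V, 1 * x ∈ V') :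
    Function.Surjective (SubQ.mul 1 hU hV) := by
  intro m
  obtain ⟨x, hx, rfl⟩ := m.exists_rep
  refine ⟨SubQ.mk x hx, ?_⟩
  rw [SubQ.mul_mk, SubQ.mk_eq_mk, one_mul, sub_self]
  exact V'.zero_mem

lemma SubQ.mul_exact {W W' : Ideal R} {b : R} (hU : ∀ x ∈ U, b * x ∈ U')
    (hV : ∀ x ∈ V, b * x ∈ W) (hU' : ∀ x ∈ U', 1 * x ∈ U') (hW : ∀ x ∈ W, 1 * x ∈ W')
    (hmem : ∀ x ∈ U, b * x ∈ W') (hdec : ∀ y ∈ W', ∃ x ∈ U, y - b * x ∈ W) :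
    Function.Exact (SubQ.mul b hU hV) (SubQ.mul 1 hU' hW) := by
  intro m
  constructor
  · intro hm
    obtain ⟨y, hy, rfl⟩ := m.exists_rep
    rw [SubQ.mul_mk, SubQ.mk_eq_zero, one_mul] at hm
    obtain ⟨x, hx, hyx⟩ := hdec y hm
    refine ⟨SubQ.mk x hx, ?_⟩
    rw [SubQ.mul_mk, SubQ.mk_eq_mk, ← neg_sub]
    exact W.neg_mem hyx
  · rintro ⟨m, rfl⟩
    obtain ⟨x, hx, rfl⟩ := m.exists_rep
    rw [SubQ.mul_mk, SubQ.mul_mk, SubQ.mk_eq_zero, one_mul]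
    exact hmem x hx

/-- The inclusion of `U / (U ∩ V)` into `R / V`. -/
def SubQ.incl (U V : Ideal R) : SubQ U V →ₗ[R] R ⧸ V :=
  Submodule.mapQ (Submodule.comap U.subtype V) V U.subtype le_rfl

lemma SubQ.incl_mk {x : R} (hx : x ∈ U) :
    SubQ.incl U V (SubQ.mk x hx) = Ideal.Quotient.mk V x := rfl

lemma SubQ.incl_injective : Function.Injective (SubQ.incl U V) := by
  rw [injective_iff_map_eq_zero]
  intro m hm
  obtain ⟨x, hx, rfl⟩ := m.exists_rep
  rw [SubQ.incl_mk, Ideal.Quotient.eq_zero_iff_mem] at hm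
  exact SubQ.mk_eq_zero.mpr hm

lemma SubQ.incl_surjective (hU : U = ⊤) : Function.Surjective (SubQ.incl U V) := by
  intro m
  obtain ⟨x, rfl⟩ := Ideal.Quotient.mk_surjective m
  exact ⟨SubQ.mk x (hU ▸ Submodule.mem_top), rfl⟩

lemma SubQ.incl_exact (h : ∀ y ∈ V, 1 * y ∈ U) :
    Function.Exact (SubQ.incl U V) (quotMul V U 1 h) := by
  intro m
  obtain ⟨x, rfl⟩ := Ideal.Quotient.mk_surjective m
  have h1 : quotMul V U 1 h (Ideal.Quotient.mk V x) = Ideal.Quotient.mk U x := by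
    rw [quotMul_mk, one_mul]
  rw [h1, Ideal.Quotient.eq_zero_iff_mem]
  constructor
  · exact fun hx => ⟨SubQ.mk x hx, rfl⟩
  · rintro ⟨m, hm⟩
    obtain ⟨y, hy, rfl⟩ := m.exists_rep
    rw [SubQ.incl_mk, Ideal.Quotient.eq] at hm
    have h2 := U.sub_mem hy (by simpa using h _ hm)
    rwa [sub_sub_cancel] at h2

end Subquotient

/-! ### Local cohomological vanishing for powers -/

namespace Residual

variable {R : Type u} [CommRing R] {I : Ideal R} {g s : ℕ} {a : ℕ → Ideal R} {b : ℕ → R}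

/-- The module `I ^ j / a i * I ^ (j - 1)`. -/
abbrev PowQ (I : Ideal R) (a : ℕ → Ideal R) (i j : ℕ) : Type u :=
  SubQ (I ^ j) (a i * I ^ (j - 1))

lemma mul_mem_pow {x : R} (hx : x ∈ I) (j : ℕ) : ∀ y ∈ I ^ j, x * y ∈ I ^ (j + 1) :=
  fun y hy => by
  rw [pow_succ']
  exact Ideal.mul_mem_mul hx hy

lemma mul_mem_mul_pow {x : R} (hx : x ∈ I) (i j : ℕ) :
    ∀ y ∈ a i * I ^ (j - 1), x * y ∈ a i * I ^ (j + 1 - 1) := by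
  have hle : ∀ z ∈ I ^ (j - 1), x * z ∈ I ^ j := fun z hz => by
    cases j with
    | zero => simp
    | succ j => exact mul_mem_pow hx j z hz
  intro y hy
  induction hy using Submodule.mul_induction_on' with
  | mem_mul_mem u hu z hz =>
    rw [mul_left_comm]
    exact Ideal.mul_mem_mul hu (hle z hz)
  | add u hu z hz h₁ h₂ =>
    rw [mul_add]
    exact Ideal.add_mem _ h₁ h₂

/-- Multiplication by an element of `I`. -/
def mulMap (a : ℕ → Ideal R) {x : R} (hx : x ∈ I) (i j : ℕ) :
    PowQ I a i j →ₗ[R] PowQ I a i (j + 1) :=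
  SubQ.mul x (mul_mem_pow hx j) (mul_mem_mul_pow hx i j)

lemma mulMap_comm {x y : R} (hx : x ∈ I) (hy : y ∈ I) (i j : ℕ) :
    y • mulMap a hx i j = x • mulMap a hy i j := by
  ext m
  obtain ⟨z, hz, rfl⟩ := m.exists_rep
  rw [LinearMap.smul_apply, LinearMap.smul_apply, mulMap, mulMap, SubQ.mul_mk, SubQ.mul_mk,
    SubQ.smul_mk, SubQ.smul_mk, SubQ.mk_eq_mk, mul_left_comm, sub_self]
  exact Ideal.zero_mem _

/-- No element of `I ^ j / a i * I ^ (j - 1)` has annihilator `q` locally at `q`. -/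
def NoSocle (I : Ideal R) (a : ℕ → Ideal R) (q : Ideal R) (i j : ℕ) : Prop :=
  ∀ y ∈ I ^ j, (∀ z ∈ q, InSat q (a i * I ^ (j - 1)) (z * y)) → InSat q (a i * I ^ (j - 1)) y

/-- The vanishing of socles at primes of height less than `e`. -/
def NoSocleBelow (I : Ideal R) (a : ℕ → Ideal R) (g s e : ℕ) : Prop :=
  ∀ q : Ideal R, q.IsPrime → I ≤ q → q.height < e → ∀ i < s, ∀ j : ℕ,
    q.height + 1 ≤ ((g + j : ℕ) : ℕ∞) → NoSocle I a q i j

variable [IsLocalRing R] [IsNoetherianRing R] (H : Residual I g s a b)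

include H

lemma succ_le {i : ℕ} (hi : i < s) (j : ℕ) :
    ∀ x ∈ a i * I ^ (j - 1), 1 * x ∈ a (i + 1) * I ^ (j - 1) :=
  one_mul_mem_of_le (Ideal.mul_mono_left (H.mono (by omega) hi))

/-- The canonical projection to the next residual. -/
def proj {i : ℕ} (hi : i < s) (j : ℕ) : PowQ I a i j →ₗ[R] PowQ I a (i + 1) j :=
  SubQ.mul 1 (one_mul_mem_of_le le_rfl) (H.succ_le hi j)

lemma proj_surjective {i : ℕ} (hi : i < s) (j : ℕ) : Function.Surjective (H.proj hi j) :=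
  SubQ.mul_one_surjective _ _

lemma exists_decomp {i : ℕ} (hi : i < s) (j : ℕ) {y : R} (hy : y ∈ a (i + 1) * I ^ j) :
    ∃ w ∈ I ^ j, y - b i * w ∈ a i * I ^ j := by
  rw [H.step i hi, Ideal.sup_mul] at hy
  obtain ⟨α, hα, z, hz, rfl⟩ := Submodule.mem_sup.mp hy
  obtain ⟨w, hw, rfl⟩ := Ideal.mem_span_singleton_mul.mp hz
  exact ⟨w, hw, by rwa [add_sub_cancel_right]⟩

lemma exact_proj {i : ℕ} (hi : i < s) (j : ℕ) :
    Function.Exact (mulMap a (H.b_mem hi) i j) (H.proj hi (j + 1)) :=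
  SubQ.mul_exact _ _ _ _ (fun _ hx => Ideal.mul_mem_mul (H.b_mem_succ hi) hx)
    fun _ hy => H.exists_decomp hi j hy

lemma inSat_of_height_le_of_le {i j : ℕ} (hi : i < s) (hj : 1 ≤ j) {q : Ideal R} (hq : q.IsPrime)
    (hIq : I ≤ q) (hqi : q.height ≤ i) {y : R} (hy : y ∈ I ^ j) :
    InSat q (a i * I ^ (j - 1)) y := by
  obtain ⟨u, hu, huI⟩ := H.gen i hi q hq hIq hqi
  refine ⟨u, hu, ?_⟩
  obtain ⟨j, rfl⟩ := Nat.exists_eq_succ_of_ne_zero (by omega : j ≠ 0)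
  rw [Nat.succ_eq_add_one, pow_succ'] at hy
  rw [Nat.succ_eq_add_one, Nat.add_sub_cancel]
  induction hy using Submodule.mul_induction_on' with
  | mem_mul_mem x hx z hz =>
    rw [← mul_assoc]
    exact Ideal.mul_mem_mul (huI x hx) hz
  | add x hx z hz h₁ h₂ =>
    rw [mul_add]
    exact Ideal.add_mem _ h₁ h₂

/-- Injectivity, locally at `q`, of multiplication by `b i`. -/
lemma inSat_of_mul_b_mem {i j : ℕ} (hi : i < s) (hj : 1 ≤ j) {q : Ideal R} (hq : q.IsPrime)
    (hN : ∀ q' : Ideal R, q'.IsPrime → I ≤ q' → q' ≤ q → ¬ q'.height ≤ i → NoSocle I a q' i j)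
    {y : R} (hy : y ∈ I ^ j) (hby : b i * y ∈ a i * I ^ j) : InSat q (a i * I ^ (j - 1)) y := by
  by_contra hcon
  obtain ⟨q', hq', hle, r, hr⟩ := exists_assp_of_not_inSat hq hcon
  have hry : r * y ∈ I ^ j := Ideal.mul_mem_left _ _ hy
  have key : ¬ InSat q' (a i * I ^ (j - 1)) (r * y) := by
    rintro ⟨u, hu, huy⟩
    exact hu ((hr u).mp huy)
  by_cases hIq : I ≤ q'
  · by_cases hht : q'.height ≤ i
    · exact key (H.inSat_of_height_le_of_le hi hj hq' hIq hht hry)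
    · exact key (hN q' hq' hIq hle hht _ hry fun z hz =>
        InSat.of_mem hq' ((hr z).mpr hz))
  · obtain ⟨u, hu, huq⟩ := SetLike.not_le_iff_exists.mp hIq
    refine key (InSat.mul_left r ⟨u ^ (j - 1) * u, not_mem_mul hq'
      (fun h => huq (hq'.mem_of_pow_mem _ h)) huq, ?_⟩)
    have hyK : y ∈ Submodule.colon (a i) I :=
      (H.mem_colon_iff hi).mpr (by rw [mul_comm]; exact Ideal.mul_le_left hby)
    rw [show u ^ (j - 1) * u * y = (y * u) * u ^ (j - 1) by ring]
    exact Ideal.mul_mem_mul (Submodule.mem_colon.mp hyK u hu) (Ideal.pow_mem_pow hu _)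

lemma lz_ker {i j : ℕ} (hi : i < s) (hj : 1 ≤ j) {q : Ideal R} (hq : q.IsPrime)
    (hN : ∀ q' : Ideal R, q'.IsPrime → I ≤ q' → q' ≤ q → ¬ q'.height ≤ i → NoSocle I a q' i j) :
    LZ (LinearMap.ker (mulMap a (H.b_mem hi) i j)) q := by
  rintro ⟨m, hm⟩
  obtain ⟨y, hy, rfl⟩ := m.exists_rep
  rw [LinearMap.mem_ker, mulMap, SubQ.mul_mk, SubQ.mk_eq_zero] at hm
  obtain ⟨u, hu, huy⟩ := H.inSat_of_mul_b_mem hi hj hq hN hy hm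
  exact ⟨u, hu, Subtype.ext (SubQ.mk_eq_zero.mpr huy)⟩

lemma ev_ker {i j k : ℕ} (hi : i < s) (hj : 1 ≤ j) {p : Ideal R} (hp : p.IsPrime)
    (hN : ∀ q : Ideal R, q.IsPrime → I ≤ q → ¬ q.height ≤ i → q.height ≤ k → NoSocle I a q i j) :
    EV (LinearMap.ker (mulMap a (H.b_mem hi) i j)) k p :=
  H.hE.ev_of_support hp _ fun _ hq _ hqk => H.lz_ker hi hj hq fun q' hq' hIq' hle hht =>
    hN q' hq' hIq' hht ((Ideal.height_mono hle).trans hqk)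

lemma ker_zero_subsingleton {i : ℕ} (hi : i < g) (hi' : i < s) :
    Subsingleton (LinearMap.ker (mulMap a (H.b_mem hi') i 0)) := by
  refine ⟨fun m m' => ?_⟩
  have : ∀ m : LinearMap.ker (mulMap a (H.b_mem hi') i 0), m = 0 := by
    rintro ⟨m, hm⟩
    obtain ⟨y, hy, rfl⟩ := m.exists_rep
    rw [LinearMap.mem_ker, mulMap, SubQ.mul_mk, SubQ.mk_eq_zero] at hm
    refine Subtype.ext (SubQ.mk_eq_zero.mpr ?_)
    have hm' : y * b i ∈ a i := by rw [mul_comm]; exact Ideal.mul_le_left hm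
    have := H.b_regular hi (H.regIdeal hi.le) y hm'
    simpa using this
  rw [this m, this m']

lemma ev_powQ_zero {i k : ℕ} (hi : i ≤ g) (hk : i < k) {p : Ideal R} (hp : p.IsPrime) :
    EV (PowQ I a i 0) k p := by
  have hreg := (H.regIdeal hi).exists_class.1 k hk
  have ha : a i * I ^ (0 - 1) = a i := by simp
  let e : PowQ I a i 0 ≃ₗ[R] R ⧸ (a i * I ^ (0 - 1)) :=
    LinearEquiv.ofBijective (SubQ.incl _ _) ⟨SubQ.incl_injective, SubQ.incl_surjective (by simp)⟩
  refine EV.of_equiv e.symm (EV.of_forall_eq_zero hp ?_)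
  rw [ha]
  exact hreg

lemma ev_powQ {e : ℕ} (hX : NoSocleBelow I a g s e) {p : Ideal R} (hp : p.IsPrime) (hIp : I ≤ p)
    (hps : p.height ≤ s) {i : ℕ} : ∀ {j k : ℕ}, 1 ≤ j → j ≤ s - g → g + j ≤ e + 2 → i + 2 ≤ g + j →
      k + 1 = g + j → EV (PowQ I a i j) k p := by
  have hgs := H.hgs
  induction i with
  | zero =>
    intro j k hj hjs _ hij hk
    have hreg := (RegIdeal.zero (R := R)).exists_class.1 k (by omega)
    have ha : a 0 * I ^ (j - 1) = ⊥ := by rw [H.zero, Ideal.bot_mul]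
    have hle : ∀ y ∈ a 0 * I ^ (j - 1), 1 * y ∈ I ^ j :=
      one_mul_mem_of_le (ha ▸ bot_le)
    refine EV.left hp SubQ.incl_injective (SubQ.incl_exact hle)
      (quotMul_one_surjective (ha ▸ bot_le)) (EV.of_forall_eq_zero hp ?_) ?_
    · rw [ha]
      exact hreg
    · rw [hk]
      exact H.ext p hp hIp hps j hj hjs
  | succ i ih =>
    intro j k hj hjs hje hij hk
    obtain ⟨j, rfl⟩ := Nat.exists_eq_succ_of_ne_zero (by omega : j ≠ 0)
    obtain ⟨k, rfl⟩ := Nat.exists_eq_succ_of_ne_zero (by omega : k ≠ 0)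
    have his : i < s := by omega
    refine EV.coker hp (H.exact_proj his j) (H.proj_surjective his (j + 1)) ?_ ?_
      (ih hj hjs hje (by omega) hk)
    · rcases Nat.eq_zero_or_pos j with rfl | hj0
      · exact H.ev_powQ_zero (by omega) (by omega) hp
      · exact ih hj0 (by omega) (by omega) (by omega) (by omega)
    · intro k' hk'
      rcases Nat.eq_zero_or_pos j with rfl | hj0
      · have := H.ker_zero_subsingleton (i := i) (by omega) his
        exact EV.of_subsingleton hp
      · refine H.ev_ker his hj0 hp fun q hq hIq _ hqk => hX q hq hIq ?_ i his j ?_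
        · exact lt_of_le_of_lt hqk (by exact_mod_cast (by omega : k' < e))
        · refine (add_le_add_left hqk 1).trans ?_
          exact_mod_cast (by omega : k' + 1 ≤ g + j)

lemma noSocleBelow (e : ℕ) (hes : e ≤ s) : NoSocleBelow I a g s e := by
  have hgs := H.hgs
  induction e with
  | zero => exact fun q _ _ hq => absurd hq (by simp)
  | succ e ih =>
    have hX := ih (by omega)
    intro q hq hIq hqe i hi j hj
    obtain ⟨d, hd⟩ := exists_height_eq hq
    have hde : d ≤ e := by
      rw [hd] at hqe
      norm_cast at hqe
      omega
    rcases hde.lt_or_eq with hlt | rfl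
    · exact hX q hq hIq (by rw [hd]; exact_mod_cast hlt) i hi j hj
    rw [hd] at hj
    have hj' : d + 1 ≤ g + j := by exact_mod_cast hj
    have hgd : g ≤ d := by
      have := H.grade q hq hIq
      rw [hd] at this
      exact_mod_cast this
    clear hj
    obtain ⟨l, rfl⟩ : ∃ l, j = d + 1 - g + l := ⟨j - (d + 1 - g), by omega⟩
    clear hj'
    have hhigh : ∀ l i, i < s → d ≤ i → NoSocle I a q i (d + 1 - g + l) :=
      fun l i hi hdi y hy _ => H.inSat_of_height_le_of_le hi (by omega) hq hIq
        (by rw [hd]; exact_mod_cast hdi) hy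
    induction l generalizing i with
    | zero =>
      rcases le_or_gt d i with hdi | hdi
      · exact hhigh 0 i hi hdi
      intro y hy hsoc
      have hEV : EV (PowQ I a i (d + 1 - g + 0)) d q :=
        H.ev_powQ hX hq hIq (by rw [hd]; exact_mod_cast (by omega : d ≤ s)) (by omega) (by omega)
          (by omega) (by omega) (by omega)
      obtain ⟨u, hu, hum⟩ := H.hE.eq_zero_of_socle hq hd hEV (SubQ.mk y hy) (fun z hz => by
        obtain ⟨u, hu, huz⟩ := hsoc z hz
        exact ⟨u, hu, by rw [SubQ.smul_mk, SubQ.smul_mk, SubQ.mk_eq_zero]; exact huz⟩)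
      rw [SubQ.smul_mk, SubQ.mk_eq_zero] at hum
      exact ⟨u, hu, hum⟩
    | succ l ihl =>
      obtain ⟨n, hn⟩ : ∃ n, n + i = s - 1 := ⟨s - 1 - i, by omega⟩
      induction n generalizing i with
      | zero => exact hhigh _ i hi (by omega)
      | succ n ihn =>
        rcases le_or_gt d i with hdi | hdi
        · exact hhigh _ i hi hdi
        have hprev := ihl i hi
        have hnext := ihn (i + 1) (by omega) (by omega)
        rw [← add_assoc] at hnext ⊢
        set j := d + 1 - g + l with hjdef
        have hj1 : 1 ≤ j := by omega
        have hN : ∀ q' : Ideal R, q'.IsPrime → I ≤ q' → q' ≤ q → ¬ q'.height ≤ i →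
            NoSocle I a q' i j := by
          intro q' hq' hIq' hle _
          rcases hle.lt_or_eq with hlt | rfl
          · have h1 := height_add_one_le hq' hq hlt
            obtain ⟨d', hd'⟩ := exists_height_eq hq'
            rw [hd, hd'] at h1
            have h2 : d' + 1 ≤ d := by exact_mod_cast h1
            refine hX q' hq' hIq' ?_ i hi j ?_
            · rw [hd']
              exact_mod_cast (by omega : d' < d)
            · rw [hd']
              exact_mod_cast (by omega : d' + 1 ≤ g + j)
          · exact hprev
        have hle : a i * I ^ (j + 1 - 1) ≤ a (i + 1) * I ^ (j + 1 - 1) :=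
          Ideal.mul_mono_left (H.mono (by omega) (by omega))
        intro y hy hsoc
        obtain ⟨u, hu, huy⟩ := hnext y hy fun z hz => (hsoc z hz).mono hle
        obtain ⟨w, hw, hwy⟩ := H.exists_decomp hi j huy
        have hwsat : InSat q (a i * I ^ (j - 1)) w := by
          refine hprev w hw fun z hz => ?_
          have h1 : InSat q (a i * I ^ j) (b i * (z * w)) := by
            rw [show b i * (z * w) = u * (z * y) - z * (u * y - b i * w) by ring]
            exact ((hsoc z hz).mul_left u).sub hq (InSat.of_mem hq (Ideal.mul_mem_left _ _ hwy))
          obtain ⟨v, hv, hvw⟩ := h1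
          refine InSat.of_mul hq hv (H.inSat_of_mul_b_mem hi hj1 hq hN
            (Ideal.mul_mem_left _ _ (Ideal.mul_mem_left _ _ hw)) ?_)
          rwa [mul_left_comm]
        obtain ⟨v, hv, hvw⟩ := hwsat
        refine InSat.of_mul hq hu ?_
        rw [← sub_add_cancel (u * y) (b i * w)]
        refine (InSat.of_mem hq hwy).add hq ⟨v, hv, ?_⟩
        rw [mul_left_comm]
        exact mul_mem_mul_pow (H.b_mem hi) i j _ hvw

end Residual

/-! ### Faithfulness of the modules `I ^ (t + 1) / 𝔞 I ^ t` over residual intersections -/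

namespace Residual

variable {R : Type u} [CommRing R] [IsLocalRing R] [IsNoetherianRing R] {I : Ideal R} {g s : ℕ}
  {a : ℕ → Ideal R} {b : ℕ → R} (H : Residual I g s a b)

include H

lemma exists_class_grade {p : Ideal R} (hp : p.IsPrime) (hIp : I ≤ p) (hps : p.height ≤ s) :
    ∃ ε : MExt R (PowQ I a g 1) R g,
      (∀ y : R, y • ε = 0 → InSat p (Submodule.colon (a g) I) y) ∧ Gen ε p := by
  have hgs := H.hgs
  have ha : a g * I ^ (1 - 1) = a g := by simp
  have hle : a g * I ^ (1 - 1) ≤ I ^ 1 := by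
    rw [ha, pow_one]
    exact H.a_le (by omega)
  have hreg : RegIdeal (a g * I ^ (1 - 1)) g := by
    rw [ha]
    exact H.regIdeal le_rfl
  obtain ⟨-, ε, hε, hann⟩ := hreg.exists_class
  have hle' := one_mul_mem_of_le hle
  have hex := SubQ.incl_exact hle'
  have hsurj := quotMul_one_surjective hle
  refine ⟨pull (SubQ.incl _ _) R g ε, fun y hy => ⟨1, one_not_mem hp, ?_⟩, fun ξ => ?_⟩
  · rw [← map_smul] at hy
    obtain ⟨η, hη⟩ := pull_exact _ _ SubQ.incl_injective hex hsurj g _ hy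
    rw [one_mul]
    refine Submodule.mem_colon.mpr fun x hx => ?_
    have hxη : x • η = 0 := smul_eq_zero_of_forall_smul_eq_zero x
      (smul_quotient_eq_zero (I ^ 1) x (by rwa [pow_one])) g η
    have h1 : (y * x) • ε = 0 := by
      rw [mul_smul, smul_comm, ← hη, ← map_smul, hxη, map_zero]
    have := hann _ h1
    rwa [ha] at this
  · obtain ⟨δ, -, hδ, -, -⟩ := exists_connecting _ _ SubQ.incl_injective hex hsurj R g
    obtain ⟨u, hu, huξ⟩ := H.ext p hp hIp hps 1 le_rfl (by omega) (δ ξ)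
    rw [← map_smul] at huξ
    obtain ⟨η, hη⟩ := hδ _ huξ
    obtain ⟨z, rfl⟩ := hε η
    exact ⟨u, hu, z, by rw [← hη, map_smul]⟩

lemma ev_ker_of_le {i j k : ℕ} (hi : i < s) (hj : 1 ≤ j) (hk : k ≤ i) {p : Ideal R}
    (hp : p.IsPrime) : EV (LinearMap.ker (mulMap a (H.b_mem hi) i j)) k p :=
  H.ev_ker hi hj hp fun _ _ _ hqi hqk => absurd (hqk.trans (by exact_mod_cast hk)) hqi

lemma inSat_colon_succ {i j k : ℕ} (hi : i < s) {p : Ideal R} (hp : p.IsPrime)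
    {ε : MExt R (PowQ I a i j) R k}
    (hann : ∀ y : R, y • ε = 0 → InSat p (Submodule.colon (a i) I) y) (hgen : Gen ε p) {y : R}
    {η : MExt R (PowQ I a i (j + 1)) R k} (hη : y • ε = pull (mulMap a (H.b_mem hi) i j) R k η) :
    InSat p (Submodule.colon (a (i + 1)) I) y := by
  have key : ∀ x ∈ I, InSat p (a (i + 1)) (y * x) := fun x hx => by
    obtain ⟨w, hw, z, hz⟩ := hgen (pull (mulMap a hx i j) R k η)
    have hcomm : b i • pull (mulMap a hx i j) R k η =
        x • pull (mulMap a (H.b_mem hi) i j) R k η := by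
      rw [← pull_smul, ← pull_smul, mulMap_comm]
    have h0 : (w * (y * x) - z * b i) • ε = 0 := by
      rw [sub_smul, show w * (y * x) = (w * x) * y by ring, mul_smul (w * x), hη, mul_smul w,
        ← hcomm, smul_comm w, hz, ← mul_smul, mul_comm z, sub_self]
    exact InSat.of_mul hp hw
      (H.inSat_succ hi (I.mul_mem_left _ (I.mul_mem_left _ hx)) (hann _ h0))
  obtain ⟨u, hu, huy⟩ := exists_uniform hp (𝔞 := Ideal.span {y} * I) fun z hz => by
    obtain ⟨x, hx, rfl⟩ := Ideal.mem_span_singleton_mul.mp hz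
    exact key x hx
  refine ⟨u, hu, Submodule.mem_colon.mpr fun x hx => ?_⟩
  rw [smul_eq_mul, mul_assoc]
  exact huy _ (Ideal.mem_span_singleton_mul.mpr ⟨x, hx, rfl⟩)

lemma exists_class {p : Ideal R} (hp : p.IsPrime) (hIp : I ≤ p) (hps : p.height ≤ s) (m : ℕ)
    (hm : g + m ≤ s) : ∃ ε : MExt R (PowQ I a (g + m) (m + 1)) R (g + m),
      (∀ y : R, y • ε = 0 → InSat p (Submodule.colon (a (g + m)) I) y) ∧
      (g + m < s → Gen ε p) := by
  induction m with
  | zero =>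
    obtain ⟨ε, hann, hgen⟩ := H.exists_class_grade hp hIp hps
    exact ⟨ε, hann, fun _ => hgen⟩
  | succ m ih =>
    have hi : g + m < s := by omega
    obtain ⟨ε, hann, hgen⟩ := ih hi.le
    obtain ⟨ε', hann', hgen'⟩ := exists_class_coker hp (H.exact_proj hi (m + 1))
      (H.proj_surjective hi (m + 1 + 1)) (H.ev_ker_of_le hi (by omega) le_rfl hp) ε
    refine ⟨ε', fun y hy => ?_, fun hlt => ?_⟩
    · obtain ⟨v, hv, η, hη⟩ := hann' y hy
      exact InSat.of_mul hp hv (H.inSat_colon_succ hi hp hann (hgen hi) hη)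
    · exact hgen' (fun j hj => H.ev_ker_of_le hi (by omega) (by omega) hp) (hgen hi)
        (H.ev_powQ (H.noSocleBelow s le_rfl) hp hIp hps (by omega) (by omega) (by omega)
          (by omega) (by omega))

/-- An element multiplying `I ^ (t + 1)` into `𝔞 I ^ t`, where `t = s - g`, multiplies `I`
into `𝔞`. -/
theorem mem_colon_of_forall_mul_mem (hrad : ∀ p : Ideal R, p.IsPrime → a s ≤ p → I ≤ p) {y : R}
    (hy : ∀ x ∈ I ^ (s - g + 1), y * x ∈ a s * I ^ (s - g)) : y ∈ Submodule.colon (a s) I := by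
  have hgs := H.hgs
  obtain ⟨t, rfl⟩ : ∃ t, s = g + t := ⟨s - g, by omega⟩
  rw [Nat.add_sub_cancel_left] at hy
  refine Submodule.mem_colon.mpr fun x hx => mem_of_forall_assp fun q hq => ?_
  obtain ⟨ε, hann, -⟩ := H.exists_class hq.1 (hrad q hq.1 hq.le) (H.height_le le_rfl q hq) t le_rfl
  obtain ⟨u, hu, huy⟩ := hann y (smul_eq_zero_of_forall_smul_eq_zero y (fun m => by
    obtain ⟨x, hx, rfl⟩ := m.exists_rep
    rw [SubQ.smul_mk, SubQ.mk_eq_zero]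
    exact hy x hx) _ ε)
  refine ⟨u, hu, ?_⟩
  rw [smul_eq_mul, ← mul_assoc]
  exact Submodule.mem_colon.mp huy x hx

end Residual

/-! ### Existence of the residual sequence -/

section Existence

variable {R : Type u} [CommRing R]

lemma span_range_eq {a : ℕ → Ideal R} {b : ℕ → R} {s : ℕ} (h0 : a 0 = ⊥)
    (hstep : ∀ i < s, a (i + 1) = a i ⊔ Ideal.span {b i}) {i : ℕ} (hi : i ≤ s) :
    Ideal.span (Set.range fun k : Fin i => b k) = a i := by
  induction i with
  | zero => simp [h0]
  | succ i ih =>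
    rw [hstep i hi, ← ih (by omega), ← Ideal.span_union]
    congr 1
    ext x
    simp only [Set.mem_range, Set.union_singleton, Set.mem_insert_iff]
    constructor
    · rintro ⟨k, rfl⟩
      rcases Fin.eq_castSucc_or_eq_last k with ⟨k, rfl⟩ | rfl
      · exact Or.inr ⟨k, rfl⟩
      · exact Or.inl rfl
    · rintro (rfl | ⟨k, rfl⟩)
      · exact ⟨Fin.last i, rfl⟩
      · exact ⟨k.castSucc, rfl⟩

lemma exists_residual [IsLocalRing R] [IsNoetherianRing R] (hGor : IsGorensteinLocalRing R)
    {I 𝔞 : Ideal R} {g s : ℕ} (hg : idealGrade I = (g : ℕ∞)) (hs : g + 1 ≤ s)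
    (hGs : IdealGs I s) (hS2 : WeaklyResiduallyS2Lt I g s)
    (hExt : ∀ (p : Ideal R) (hp : p.IsPrime), I ≤ p → dimAt p hp ≤ (s : WithBot ℕ∞) →
      ∀ j : ℕ, 1 ≤ j → j ≤ s - g → ExtVanishesAt (R ⧸ I ^ j) R (g + j) p hp)
    (hres : IsResidualIntersection I 𝔞 s)
    (hrad : ∀ p : Ideal R, p.IsPrime → 𝔞 ≤ p → I ≤ p) :
    ∃ a b, Residual I g s a b ∧ a s = 𝔞 := by
  obtain ⟨h𝔞I, ⟨f, hf⟩, htop, hht⟩ := hres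
  have hK := le_idealHeight_iff.mp hht
  have hlist : Ideal.ofList (List.ofFn f) = 𝔞 := by
    rw [← hf, Ideal.ofList]
    congr 1
    ext x
    simp
  obtain ⟨a, b, h0, has, hstep, hgen⟩ := exists_generalPosition hrad (List.ofFn f) 0 ⊥ (by simp)
    (GeneralPosition.bot hGs h𝔞I hK) (by rw [hlist, bot_sup_eq])
  have hstep' : ∀ i < s, a (i + 1) = a i ⊔ Ideal.span {b i} := fun i hi => hstep i zero_le hi
  have hmono : ∀ i, i ≤ s → a i ≤ 𝔞 := fun i hi => by
    induction hi using Nat.decreasingInduction with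
    | self => exact has.le
    | of_succ k hk ih =>
      refine le_trans ?_ ih
      rw [hstep' k hk]
      exact le_sup_left
  have hg' : ∀ i < s, ∀ p : Ideal R, p.IsPrime → I ≤ p → p.height ≤ i →
      ∃ u, u ∉ p ∧ ∀ y ∈ I, u * y ∈ a i := fun i hi p hp hIp hpi =>
    inSat_of_height_le (hgen i zero_le hi.le) hK hp hIp hpi hi
  have hcolon : ∀ i < s, ∀ p : Ideal R, p.IsPrime → I ≤ p → Submodule.colon (a i) I ≤ p →
      ((i + 1 : ℕ) : ℕ∞) ≤ p.height := fun i hi p hp hIp hle => by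
    by_contra hcon
    have hpi : p.height ≤ i := by
      rw [not_le] at hcon
      push_cast at hcon
      exact Order.le_of_lt_add_one hcon
    obtain ⟨u, hu, huI⟩ := hg' i hi p hp hIp hpi
    exact hu (hle (Submodule.mem_colon.mpr huI))
  refine ⟨a, b, ?_, has⟩
  refine
    { hE := extGorenstein_of_isGorensteinLocalRing hGor
      hgs := hs
      grade := le_height_of_idealGrade hg
      zero := h0
      step := hstep'
      le := has.trans_le h𝔞I
      gen := hg'
      out := fun i hi => (hgen i zero_le hi).out
      serre := fun i hgi hi => hS2 i hgi hi (a i) ⟨⟨?_, ?_, ?_, ?_⟩, ?_⟩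
      ext := fun p hp hIp hps j hj hjs => ?_ }
  · exact (hmono i hi.le).trans h𝔞I
  · exact ⟨_, span_range_eq h0 hstep' hi.le⟩
  · intro h
    refine htop (top_le_iff.mp (h ▸ fun x hx => Submodule.mem_colon.mpr fun y hy => ?_))
    exact hmono i hi.le (Submodule.mem_colon.mp hx y hy)
  · refine le_idealHeight_iff.mpr fun p hp hle => ?_
    by_cases hIp : I ≤ p
    · exact le_trans (by exact_mod_cast i.le_succ) (hcolon i hi p hp hIp hle)
    · by_contra hcon
      refine (hgen i zero_le hi.le).out p hp hIp (not_le.mp hcon) (le_trans ?_ hle)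
      exact fun x hx => Submodule.mem_colon.mpr fun y _ => Ideal.mul_mem_right _ _ hx
  · exact le_idealHeight_iff.mpr fun p hp hle =>
      hcolon i hi p hp (le_sup_left.trans hle) (le_sup_right.trans hle)
  · exact exists_smul_eq_zero_of_extVanishesAt (g + j) (by omega) p hp
      (hExt p hp hIp (by rw [dimAt_eq_height]; exact_mod_cast hps) j hj hjs)

lemma pow_le_of_pow_inf_le [IsNoetherianRing R] {I 𝔞 : Ideal R} (hrad : I ≤ 𝔞.radical) {n t : ℕ}
    (hn : 0 < n) (ht : 0 < t)
    (hcolon : ∀ y, (∀ x ∈ I ^ (t + 1), y * x ∈ 𝔞 * I ^ t) → y ∈ Submodule.colon 𝔞 I)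
    (h : I ^ (n + t) ⊓ 𝔞 ≤ 𝔞 * I ^ t) : I ^ n ≤ 𝔞 := by
  obtain ⟨N, hN⟩ := Ideal.exists_pow_le_of_le_radical_of_fg hrad (IsNoetherian.noetherian I)
  have key : ∀ d m, n ≤ m → I ^ (m + d) ≤ 𝔞 → I ^ m ≤ 𝔞 := by
    intro d
    induction d with
    | zero => exact fun m _ hm => hm
    | succ d ih =>
      intro m hnm hm
      have hsucc : I ^ (m + 1) ≤ 𝔞 := ih (m + 1) (by omega) (by rwa [add_right_comm, add_assoc])
      have hpow : I ^ (m + t) ≤ 𝔞 * I ^ t :=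
        le_trans (le_inf (Ideal.pow_le_pow_right (by omega))
          ((Ideal.pow_le_pow_right (by omega)).trans hsucc)) h
      obtain ⟨m, rfl⟩ := Nat.exists_eq_succ_of_ne_zero (by omega : m ≠ 0)
      rw [Nat.succ_eq_add_one, pow_succ, Ideal.mul_le]
      intro y hy x hx
      refine Submodule.mem_colon.mp (hcolon y fun z hz => hpow ?_) x hx
      rw [show m.succ + t = m + (t + 1) by omega, pow_add]
      exact Ideal.mul_mem_mul hy hz
  exact key N n le_rfl ((Ideal.pow_le_pow_right (by omega)).trans hN)

end Existence

end ResidualExt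

/-- **Corollary 3.1** (Corso–Polini). Let `R` be a local Gorenstein ring and `I` an
`R`-ideal of grade `g` satisfying `G_s` for some `s ≥ g + 1` and unmixed locally in
codimension `s`. Suppose `I` is weakly `(s-1)`-residually `S_2` and
`Ext_R^(g+j)(R/I^j, R)_p = 0` whenever `p ∈ V(I)` with `dim R_p ≤ s` and
`1 ≤ j ≤ s - g`. Let `𝔞 : I` be an `s`-residual intersection of `I` and suppose
`𝔞` and `I` have the same radical. Then `I^n ⊆ 𝔞` iff `I^(n+s-g) ∩ 𝔞 ⊆ 𝔞 I^(s-g)`. -/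
theorem power_mem_iff_of_same_radical {R : Type u} [CommRing R] [IsLocalRing R]
    [IsNoetherianRing R] (hGor : IsGorensteinLocalRing R)
    (I : Ideal R) (g s : ℕ) (hg : idealGrade I = (g : ℕ∞)) (hs : g + 1 ≤ s)
    (hGs : IdealGs I s)
    (hunmixed : ∀ (p : Ideal R) (hp : p.IsPrime), p ∈ associatedPrimes R (R ⧸ I) →
      dimAt p hp ≤ (s : WithBot ℕ∞) → dimAt p hp = ((g : ℕ∞) : WithBot ℕ∞))
    (hS2 : WeaklyResiduallyS2Lt I g s)
    (hExt : ∀ (p : Ideal R) (hp : p.IsPrime), I ≤ p → dimAt p hp ≤ (s : WithBot ℕ∞) →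
      ∀ j : ℕ, 1 ≤ j → j ≤ s - g → ExtVanishesAt (R ⧸ I ^ j) R (g + j) p hp)
    (𝔞 : Ideal R) (hres : IsResidualIntersection I 𝔞 s)
    (hrad : 𝔞.radical = I.radical) (n : ℕ) (hn : 0 < n) :
    I ^ n ≤ 𝔞 ↔ I ^ (n + s - g) ⊓ 𝔞 ≤ 𝔞 * I ^ (s - g) := by
  rw [Nat.add_sub_assoc (by omega)]
  constructor
  · intro h
    rw [pow_add]
    exact inf_le_left.trans (Ideal.mul_mono_left h)
  · have hI : I ≤ 𝔞.radical := Ideal.le_radical.trans hrad.ge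
    have hprime : ∀ p : Ideal R, p.IsPrime → 𝔞 ≤ p → I ≤ p :=
      fun p hp h => hI.trans (hp.radical_le_iff.mpr h)
    obtain ⟨a, b, H, rfl⟩ :=
      ResidualExt.exists_residual hGor hg hs hGs hS2 hExt hres hprime
    exact ResidualExt.pow_le_of_pow_inf_le hI hn (by omega)
      fun y hy => H.mem_colon_of_forall_mul_mem hprime hy
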